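/- arXiv:1306.6100 — 3 statements merged into one kernel-verified Lean document; each statement's English description precedes it below -/
import Mathlib

section
/- For a group K acting on itself by conjugation, the shuffle homomorphism τ: Tot_*(C_*(EK,ℤ) ⊗_ℤ C_*(EK,ℤ)) → C_*(EK,ℤ), defined on generators by τ(g₁,...,g_p,g‖k₁,...,k_q,k) = Σ_{λ ∈ Shuff(p,q)} (gk)⁻¹ · (-1)^{|λ|} λ[g₁|...|g_p|gk₁g⁻¹|...|gk_qg⁻¹], is a chain map. -/
open Finsupp

namespace Stmt7

/-- Merge the entries at positions `i` and `i+1` of a tuple. -/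
def mergeD {α : Type} [Mul α] {n : ℕ} (i : ℕ) (h : Fin (n + 1) → α) : Fin n → α :=
  fun j =>
    if (j : ℕ) < i then h j.castSucc
    else if (j : ℕ) = i then h j.castSucc * h j.succ
    else h j.succ

variable (K : Type) [Group K]

/-- `n`-chains of the bar resolution of `K`. -/
abbrev Ch (n : ℕ) : Type := (Fin (n + 1) → K) →₀ ℤ

/-- The bar differential on a generator. -/
noncomputable def barDgen {n : ℕ} (h : Fin (n + 2) → K) : Ch K n :=
  Finsupp.single (fun j => h j.succ) 1 +
    ∑ i ∈ Finset.range (n + 1), ((-1 : ℤ) ^ (i + 1)) • Finsupp.single (mergeD i h) 1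

/-- The bar differential `∂_K`. -/
noncomputable def barD (n : ℕ) : Ch K (n + 1) →+ Ch K n :=
  Finsupp.liftAddHom fun h => (zmultiplesHom (Ch K n)) (barDgen K h)

/-- Degree `n` part of `Tot(C_*(EK,ℤ) ⊗_ℤ C_*(EK,ℤ))` (for the conjugation action). -/
abbrev TotCh (n : ℕ) : Type :=
  ((Σ p : Fin (n + 1), (Fin ((p : ℕ) + 1) → K) × (Fin ((n - (p : ℕ)) + 1) → K)) →₀ ℤ)

/-- The total differential `∂ ⊗ 1 ⊕ (-1)^p 1 ⊗ ∂` on a generator. -/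
noncomputable def totDgen {n : ℕ}
    (x : Σ p : Fin (n + 2), (Fin ((p : ℕ) + 1) → K) × (Fin ((n + 1 - (p : ℕ)) + 1) → K)) :
    TotCh K n :=
  (if hp : 1 ≤ (x.1 : ℕ) then
    Finsupp.mapDomain
      (fun gs' : Fin (((x.1 : ℕ) - 1) + 1) → K =>
        (⟨⟨(x.1 : ℕ) - 1, by have := x.1.isLt; omega⟩,
          (gs', fun j => x.2.2 (Fin.cast (by
            show (n - ((x.1 : ℕ) - 1)) + 1 = (n + 1 - (x.1 : ℕ)) + 1
            omega) j))⟩ :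
            Σ p : Fin (n + 1), (Fin ((p : ℕ) + 1) → K) × (Fin ((n - (p : ℕ)) + 1) → K)))
      (barDgen K (fun j => x.2.1 (Fin.cast (by omega) j)))
  else 0) +
  (if hq : (x.1 : ℕ) ≤ n then
    ((-1 : ℤ) ^ (x.1 : ℕ)) • Finsupp.mapDomain
      (fun ks' : Fin ((n - (x.1 : ℕ)) + 1) → K =>
        (⟨⟨(x.1 : ℕ), by omega⟩, (x.2.1, ks')⟩ :
            Σ p : Fin (n + 1), (Fin ((p : ℕ) + 1) → K) × (Fin ((n - (p : ℕ)) + 1) → K)))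
      (barDgen K (fun j => x.2.2 (Fin.cast (by omega) j)))
  else 0)

/-- The total differential. -/
noncomputable def totD (n : ℕ) : TotCh K (n + 1) →+ TotCh K n :=
  Finsupp.liftAddHom fun x => (zmultiplesHom (TotCh K n)) (totDgen K x)

/-- A `(p,q)`-shuffle: a permutation of `Fin (p+q)` monotone on the first `p` and the
last `q` letters. -/
def IsShuffle (p q : ℕ) (σ : Equiv.Perm (Fin (p + q))) : Prop :=
  ∀ i j : Fin (p + q), i < j → (((j : ℕ) < p) ∨ (p ≤ (i : ℕ))) → σ i < σ j

/-- Product `g_d ⋯ g_{p-1}` of a tail of a tuple. -/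
def prefixProd {p : ℕ} (gs : Fin p → K) (d : ℕ) : K := ((List.ofFn gs).drop d).prod

/-- The tuple `λ[g₁|…|g_p|k₁|…|k_q]` associated to a `(p,q)`-shuffle `λ`:
`s_{λ(i)} = gᵢ` for `i ≤ p` and
`s_{λ(i)} = (g_{p+λ(i)-i+1}⋯g_p)·k_{i-p}·(g_{p+λ(i)-i+1}⋯g_p)⁻¹` for `i > p`. -/
def shuffleTuple (p q : ℕ) (σ : Equiv.Perm (Fin (p + q))) (gs : Fin p → K)
    (ks : Fin q → K) : Fin (p + q) → K :=
  fun j =>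
    if h : ((σ.symm j : Fin (p + q)) : ℕ) < p then gs ⟨(σ.symm j : Fin (p + q)), h⟩
    else
      prefixProd K gs (p + (j : ℕ) - ((σ.symm j : Fin (p + q)) : ℕ)) *
        ks ⟨((σ.symm j : Fin (p + q)) : ℕ) - p, by
          have := (σ.symm j).isLt; omega⟩ *
        (prefixProd K gs (p + (j : ℕ) - ((σ.symm j : Fin (p + q)) : ℕ)))⁻¹

open scoped Classical in
/-- `τ[g₁|…|g_p‖k₁|…|k_q] = Σ_{λ ∈ Shuff(p,q)} (-1)^|λ| λ[g₁|…|g_p|k₁|…|k_q]`. -/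
noncomputable def tauBar (p q : ℕ) (gs : Fin p → K) (ks : Fin q → K) :
    ((Fin (p + q) → K) →₀ ℤ) :=
  ∑ σ ∈ Finset.univ.filter (fun σ => IsShuffle p q σ),
    (((Equiv.Perm.sign σ : ℤˣ) : ℤ)) • Finsupp.single (shuffleTuple K p q σ gs ks) 1

/-- The shuffle homomorphism on a generator:
`τ(g₁,…,g_p,g‖k₁,…,k_q,k) = Σ_λ (gk)⁻¹·(-1)^|λ| λ[g₁|…|g_p|gk₁g⁻¹|…|gk_qg⁻¹]`. -/
noncomputable def tauGen {p q : ℕ} (x : (Fin (p + 1) → K) × (Fin (q + 1) → K)) :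
    Ch K (p + q) :=
  Finsupp.mapDomain
    (fun t => Fin.snoc t (x.1 (Fin.last p) * x.2 (Fin.last q)))
    (tauBar K p q (Fin.init x.1)
      (fun i => x.1 (Fin.last p) * x.2 i.castSucc * (x.1 (Fin.last p))⁻¹))

/-- Reindexing of chains along an equality of degrees. -/
noncomputable def chCast {m m' : ℕ} (h : m = m') (x : Ch K m) : Ch K m' :=
  Finsupp.mapDomain (fun t (j : Fin (m' + 1)) => t (Fin.cast (by rw [h]) j)) x

/-- The shuffle homomorphism `τ : Tot_n(C_*(EK,ℤ) ⊗ C_*(EK,ℤ)) → C_n(EK,ℤ)`. -/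
noncomputable def tauCh (n : ℕ) : TotCh K n →+ Ch K n :=
  Finsupp.liftAddHom fun s =>
    (zmultiplesHom (Ch K n)) (chCast K (by have := s.1.isLt; omega) (tauGen K s.2))

section ListModel

variable {K}

/-- Prepend a letter to every word of a chain. -/
noncomputable def consL (a : K) : (List K →₀ ℤ) →ₗ[ℤ] (List K →₀ ℤ) :=
  Finsupp.lmapDomain ℤ ℤ (List.cons a)

/-- Multiply the first letter of a word by `a` on the left (zero on the empty word). -/
noncomputable def mergeWord (a : K) : List K → (List K →₀ ℤ)
  | [] => 0
  | b :: l => Finsupp.single ((a * b) :: l) 1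

/-- The linear extension of `mergeWord`. -/
noncomputable def mergeL (a : K) : (List K →₀ ℤ) →ₗ[ℤ] (List K →₀ ℤ) :=
  Finsupp.linearCombination ℤ (mergeWord a)

/-- The alternating sum of all merges of two consecutive letters of a word. -/
noncomputable def mergesWord : List K → (List K →₀ ℤ)
  | [] => 0
  | a :: l => -mergeWord a l - consL a (mergesWord l)

/-- The linear extension of `mergesWord`. -/
noncomputable def mergesL : (List K →₀ ℤ) →ₗ[ℤ] (List K →₀ ℤ) :=
  Finsupp.linearCombination ℤ mergesWord

/-- Drop the first letter of a word. -/
noncomputable def dropL : (List K →₀ ℤ) →ₗ[ℤ] (List K →₀ ℤ) :=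
  Finsupp.linearCombination ℤ fun l => Finsupp.single l.tail 1

/-- The bar differential on words. -/
noncomputable def barL : (List K →₀ ℤ) →ₗ[ℤ] (List K →₀ ℤ) :=
  dropL + mergesL

/-- The signed sum of shuffles of two nonempty words, whose last letters are multiplied together;
it is zero if one of the words is empty. -/
noncomputable def shuffleWord : List K → List K → (List K →₀ ℤ)
  | [], _ => 0
  | _ :: _, [] => 0
  | g :: G, k :: Q =>
    (if G = [] ∧ Q = [] then Finsupp.single [g * k] 1 else 0) +
      consL g (shuffleWord G (k :: Q)) +
      (-1 : ℤ) ^ G.length •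
        consL ((g :: G).prod * k * (g :: G).prod⁻¹) (shuffleWord (g :: G) Q)
termination_by G Q => G.length + Q.length

/-- `shuffleWord`, extended linearly in the first word. -/
noncomputable def shuffleLeft (Q : List K) : (List K →₀ ℤ) →ₗ[ℤ] (List K →₀ ℤ) :=
  Finsupp.linearCombination ℤ fun G => shuffleWord G Q

/-- `shuffleWord`, extended linearly in the second word. -/
noncomputable def shuffleRight (G : List K) : (List K →₀ ℤ) →ₗ[ℤ] (List K →₀ ℤ) :=
  Finsupp.linearCombination ℤ fun Q => shuffleWord G Q

@[simp] lemma consL_single {α : Type} (a : α) (l : List α) (c : ℤ) :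
    consL a (Finsupp.single l c) = Finsupp.single (a :: l) c := by
  simp [consL]

@[simp] lemma mergeL_single (a : K) (l : List K) :
    mergeL a (Finsupp.single l 1) = mergeWord a l := by
  simp [mergeL]

@[simp] lemma mergesL_single (l : List K) : mergesL (Finsupp.single l 1) = mergesWord l := by
  simp [mergesL]

@[simp] lemma dropL_single {α : Type} (l : List α) :
    dropL (Finsupp.single l 1) = Finsupp.single l.tail 1 := by
  simp [dropL]

@[simp] lemma shuffleLeft_single (Q G : List K) :
    shuffleLeft Q (Finsupp.single G 1) = shuffleWord G Q := by
  simp [shuffleLeft]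

@[simp] lemma shuffleRight_single (Q G : List K) :
    shuffleRight G (Finsupp.single Q 1) = shuffleWord G Q := by
  simp [shuffleRight]

@[simp] lemma shuffleWord_nil_left (Q : List K) : shuffleWord [] Q = 0 := by
  rw [shuffleWord]

@[simp] lemma shuffleWord_nil_right (G : List K) : shuffleWord G [] = 0 := by
  cases G <;> rw [shuffleWord]

lemma shuffleWord_cons_cons (g : K) (G : List K) (k : K) (Q : List K) :
    shuffleWord (g :: G) (k :: Q) =
      (if G = [] ∧ Q = [] then Finsupp.single [g * k] 1 else 0) +
        consL g (shuffleWord G (k :: Q)) +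
        (-1 : ℤ) ^ G.length •
          consL ((g :: G).prod * k * (g :: G).prod⁻¹) (shuffleWord (g :: G) Q) := by
  rw [shuffleWord]

@[simp] lemma shuffleRight_nil : shuffleRight ([] : List K) = 0 := by
  ext l : 2; simp

@[simp] lemma shuffleLeft_nil : shuffleLeft ([] : List K) = 0 := by
  ext l : 2; simp

lemma mergeL_consL (a b : K) (X : List K →₀ ℤ) : mergeL a (consL b X) = consL (a * b) X := by
  have : mergeL a ∘ₗ consL b = consL (a * b) := by ext l : 2; simp [mergeWord]
  exact LinearMap.congr_fun this X

lemma dropL_consL {α : Type} (b : α) (X : List α →₀ ℤ) : dropL (consL b X) = X := by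
  have : dropL ∘ₗ consL b = LinearMap.id := by ext l : 2; simp
  exact LinearMap.congr_fun this X

lemma mergesL_consL (a : K) (X : List K →₀ ℤ) :
    mergesL (consL a X) = -mergeL a X - consL a (mergesL X) := by
  have : mergesL ∘ₗ consL a = -mergeL a - consL a ∘ₗ mergesL := by ext l : 2; simp [mergesWord]
  exact LinearMap.congr_fun this X

/-- Merging consecutive letters shortens a word by one, keeps it nonempty and preserves its
product. -/
lemma linearMap_mergesWord_congr {M : Type*} [AddCommGroup M] (G : List K)
    (φ ψ : (List K →₀ ℤ) →ₗ[ℤ] M)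
    (h : ∀ l : List K, l ≠ [] → l.length + 1 = G.length → l.prod = G.prod →
      φ (Finsupp.single l 1) = ψ (Finsupp.single l 1)) :
    φ (mergesWord G) = ψ (mergesWord G) := by
  induction G generalizing φ ψ with
  | nil => simp [mergesWord]
  | cons a G ih =>
    have h₁ : φ (mergeWord a G) = ψ (mergeWord a G) := by
      cases G with
      | nil => simp [mergeWord]
      | cons b l => exact h _ (by simp) (by simp) (by simp [mul_assoc])
    have h₂ := ih (φ ∘ₗ consL a) (ψ ∘ₗ consL a) fun l _ hl hp => by
      simpa using h (a :: l) (by simp) (by simpa using hl) (by simp [hp])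
    simp only [LinearMap.comp_apply] at h₂
    simp [mergesWord, h₁, h₂]

lemma shuffleLeft_consL_mergesWord (g k : K) (G Q : List K) :
    shuffleLeft (k :: Q) (consL g (mergesWord G)) =
      consL g (shuffleLeft (k :: Q) (mergesWord G)) -
        (-1 : ℤ) ^ G.length • consL ((g :: G).prod * k * (g :: G).prod⁻¹)
          (shuffleLeft Q (consL g (mergesWord G))) := by
  refine linearMap_mergesWord_congr G (shuffleLeft (k :: Q) ∘ₗ consL g)
    (consL g ∘ₗ shuffleLeft (k :: Q) - (-1 : ℤ) ^ G.length •
      consL ((g :: G).prod * k * (g :: G).prod⁻¹) ∘ₗ shuffleLeft Q ∘ₗ consL g) fun l hl hn hp => ?_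
  simp only [LinearMap.sub_apply, LinearMap.smul_apply, LinearMap.comp_apply]
  simp [shuffleWord_cons_cons, hl, ← hn, hp, pow_succ, sub_eq_add_neg]

lemma shuffleRight_consL_mergesWord (g k : K) (G Q : List K) :
    shuffleRight (g :: G) (consL k (mergesWord Q)) =
      consL g (shuffleRight G (consL k (mergesWord Q))) +
        (-1 : ℤ) ^ G.length • consL ((g :: G).prod * k * (g :: G).prod⁻¹)
          (shuffleRight (g :: G) (mergesWord Q)) := by
  refine linearMap_mergesWord_congr Q (shuffleRight (g :: G) ∘ₗ consL k)
    (consL g ∘ₗ shuffleRight G ∘ₗ consL k + (-1 : ℤ) ^ G.length •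
      consL ((g :: G).prod * k * (g :: G).prod⁻¹) ∘ₗ shuffleRight (g :: G)) fun l hl _ _ => ?_
  simp only [LinearMap.add_apply, LinearMap.smul_apply, LinearMap.comp_apply]
  simp [shuffleWord_cons_cons, hl]

lemma mergeL_shuffleWord_left (g k : K) (G Q : List K) :
    mergeL g (shuffleWord G (k :: Q)) =
      shuffleLeft (k :: Q) (mergeWord g G) +
        (-1 : ℤ) ^ G.length • consL ((g :: G).prod * k * (g :: G).prod⁻¹)
          (shuffleLeft Q (mergeWord g G)) -
        (-1 : ℤ) ^ G.length • consL (g * (G.prod * k * G.prod⁻¹)) (shuffleWord G Q) := by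
  cases G with
  | nil => simp [mergeWord]
  | cons b G =>
    simp only [mergeWord, shuffleLeft_single, shuffleWord_cons_cons, map_add, mergeL_consL,
      map_zsmul, apply_ite (mergeL g), mergeL_single, map_zero, List.prod_cons, mul_assoc,
      List.length_cons, pow_succ]
    simp

lemma mergeL_shuffleWord_right (g k : K) (G Q : List K) :
    mergeL ((g :: G).prod * k * (g :: G).prod⁻¹) (shuffleWord (g :: G) Q) =
      shuffleRight (g :: G) (mergeWord k Q) - consL g (shuffleRight G (mergeWord k Q)) +
        consL (g * (G.prod * k * G.prod⁻¹)) (shuffleWord G Q) := by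
  cases Q with
  | nil => simp [mergeWord]
  | cons b Q =>
    have h₁ : (g :: G).prod * k * (g :: G).prod⁻¹ * g = g * (G.prod * k * G.prod⁻¹) := by
      simp; group
    have h₂ : (g :: G).prod * k * (g :: G).prod⁻¹ * ((g :: G).prod * b * (g :: G).prod⁻¹) =
      (g :: G).prod * (k * b) * (g :: G).prod⁻¹ := by group
    simp only [mergeWord, shuffleRight_single, shuffleWord_cons_cons, map_add, mergeL_consL,
      map_zsmul, apply_ite (mergeL _), mergeL_single, map_zero, h₁, h₂]
    by_cases h : G = [] ∧ Q = []
    · obtain ⟨rfl, rfl⟩ := h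
      simp [mul_assoc]
    · simp only [h, if_false]
      abel

/-- The inner faces of a shuffle product satisfy the Leibniz rule. -/
theorem mergesL_shuffleWord (G Q : List K) :
    mergesL (shuffleWord G Q) = shuffleLeft Q (mergesWord G) +
      (-1 : ℤ) ^ (G.length + 1) • shuffleRight G (mergesWord Q) := by
  match G, Q with
  | [], Q => simp [mergesWord]
  | g :: G, [] => simp [mergesWord]
  | g :: G, k :: Q =>
    have ih₁ := mergesL_shuffleWord G (k :: Q)
    have ih₂ := mergesL_shuffleWord (g :: G) Q
    have h₀ : mergesL (if G = [] ∧ Q = [] then Finsupp.single [g * k] 1 else 0) = 0 := by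
      split_ifs <;> simp [mergesWord, mergeWord]
    rw [shuffleWord_cons_cons, map_add, map_add, h₀, map_zsmul, mergesL_consL, mergesL_consL,
      ih₁, ih₂, mergeL_shuffleWord_left, mergeL_shuffleWord_right]
    simp only [mergesWord, map_sub, map_neg, map_add, map_zsmul, shuffleLeft_consL_mergesWord,
      shuffleRight_consL_mergesWord, List.length_cons, pow_succ]
    rcases neg_one_pow_eq_or ℤ G.length with hs | hs <;> rw [hs] <;> simp <;> abel
termination_by G.length + Q.length

/-- The list form of the bar differential is a derivation for the shuffle product in positive
total degree. -/
theorem barL_shuffleWord (G Q : List K) (hG : G ≠ []) (hQ : Q ≠ [])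
    (h : ¬(G.length = 1 ∧ Q.length = 1)) :
    barL (shuffleWord G Q) =
      shuffleLeft Q (barL (Finsupp.single G 1)) +
        (-1 : ℤ) ^ (G.length + 1) • shuffleRight G (barL (Finsupp.single Q 1)) := by
  match G, Q with
  | g :: G, k :: Q =>
    have h₀ : ¬(G = [] ∧ Q = []) := by simpa using h
    have h₁ : dropL (shuffleWord (g :: G) (k :: Q)) = shuffleWord G (k :: Q) +
        (-1 : ℤ) ^ G.length • shuffleWord (g :: G) Q := by
      simp [shuffleWord_cons_cons, h₀, dropL_consL]
    simp [barL, h₁, mergesL_shuffleWord, pow_succ]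
    abel

/-! ### The bar differential on lists -/

/-- A chain of the bar resolution, as a combination of words. -/
noncomputable def toWords (n : ℕ) : ((Fin n → K) →₀ ℤ) →ₗ[ℤ] (List K →₀ ℤ) :=
  Finsupp.lmapDomain ℤ ℤ List.ofFn

@[simp] lemma toWords_single {α : Type} {n : ℕ} (t : Fin n → α) (c : ℤ) :
    toWords n (Finsupp.single t c) = Finsupp.single (List.ofFn t) c := by
  simp [toWords]

lemma toWords_injective {α : Type} (n : ℕ) : Function.Injective (toWords (K := α) n) :=
  Finsupp.mapDomain_injective List.ofFn_injective

lemma ofFn_mergeD_zero {n : ℕ} (h : Fin (n + 2) → K) :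
    List.ofFn (mergeD 0 h) = (h 0 * h 1) :: List.ofFn fun j : Fin n => h j.succ.succ := by
  simp [List.ofFn_succ, mergeD]

lemma ofFn_mergeD_succ {n : ℕ} (i : ℕ) (h : Fin (n + 2) → K) :
    List.ofFn (mergeD (i + 1) h) = h 0 :: List.ofFn (mergeD i fun j => h j.succ) := by
  rw [List.ofFn_succ]
  congr 2
  funext j
  simp [mergeD]

lemma sum_mergeD_eq_mergesWord {n : ℕ} (h : Fin (n + 1) → K) :
    ∑ i ∈ Finset.range n, ((-1 : ℤ) ^ (i + 1)) • Finsupp.single (List.ofFn (mergeD i h)) (1 : ℤ) =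
      mergesWord (List.ofFn h) := by
  induction n with
  | zero => simp [mergesWord, mergeWord]
  | succ n ih =>
    rw [Finset.sum_range_succ', List.ofFn_succ (f := h), mergesWord, ← ih, ofFn_mergeD_zero]
    simp only [ofFn_mergeD_succ, map_sum, map_zsmul, consL_single]
    simp only [List.ofFn_succ (n := n), mergeWord, pow_succ (-1 : ℤ) (_ + 1)]
    simp
    abel

lemma toWords_barDgen {n : ℕ} (h : Fin (n + 2) → K) :
    toWords _ (barDgen K h) = barL (Finsupp.single (List.ofFn h) 1) := by
  simp only [barDgen, map_add, map_sum, map_zsmul, toWords_single, barL, LinearMap.add_apply,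
    dropL_single, mergesL_single, sum_mergeD_eq_mergesWord]
  simp [List.ofFn_succ]

lemma toWords_barD (n : ℕ) (c : Ch K (n + 1)) :
    toWords _ (barD K n c) = barL (toWords _ c) := by
  induction c using Finsupp.induction_linear with
  | zero => simp
  | add f g hf hg => simp only [map_add, hf, hg]
  | single t a =>
    have : Finsupp.single t a = a • Finsupp.single t (1 : ℤ) := by simp
    rw [this, map_zsmul, map_zsmul, map_zsmul, map_zsmul, toWords_single, ← toWords_barDgen]
    simp [barD]

/-! ### Shuffle permutations -/

/-- The permutation of `Fin (n + 1)` sending `c` to `0` and acting as `σ` on the other letters. -/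
def insertPerm {n : ℕ} (c : Fin (n + 1)) (σ : Equiv.Perm (Fin n)) : Equiv.Perm (Fin (n + 1)) :=
  c.cycleRange.trans (Equiv.Perm.decomposeFin.symm (0, σ))

lemma insertPerm_self {n : ℕ} (c : Fin (n + 1)) (σ : Equiv.Perm (Fin n)) :
    insertPerm c σ c = 0 := by
  simp [insertPerm]

lemma insertPerm_succAbove {n : ℕ} (c : Fin (n + 1)) (σ : Equiv.Perm (Fin n)) (i : Fin n) :
    insertPerm c σ (c.succAbove i) = (σ i).succ := by
  simp [insertPerm]

lemma insertPerm_symm_zero {n : ℕ} (c : Fin (n + 1)) (σ : Equiv.Perm (Fin n)) :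
    (insertPerm c σ).symm 0 = c := by
  rw [Equiv.symm_apply_eq, insertPerm_self]

lemma insertPerm_symm_succ {n : ℕ} (c : Fin (n + 1)) (σ : Equiv.Perm (Fin n)) (j : Fin n) :
    (insertPerm c σ).symm j.succ = c.succAbove (σ.symm j) := by
  rw [Equiv.symm_apply_eq, insertPerm_succAbove, Equiv.apply_symm_apply]

lemma sign_insertPerm {n : ℕ} (c : Fin (n + 1)) (σ : Equiv.Perm (Fin n)) :
    ((Equiv.Perm.sign (insertPerm c σ) : ℤˣ) : ℤ) =
      (-1) ^ (c : ℕ) * ((Equiv.Perm.sign σ : ℤˣ) : ℤ) := by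
  rw [insertPerm, Equiv.Perm.sign_trans, Fin.sign_cycleRange, Equiv.Perm.decomposeFin.symm_sign]
  simp [mul_comm]

lemma insertPerm_bijective (n : ℕ) :
    Function.Bijective fun x : Fin (n + 1) × Equiv.Perm (Fin n) => insertPerm x.1 x.2 := by
  rw [Fintype.bijective_iff_injective_and_card]
  constructor
  · rintro ⟨c, σ⟩ ⟨d, τ⟩ (h : insertPerm c σ = insertPerm d τ)
    obtain rfl : c = d := by rw [← insertPerm_symm_zero c σ, h, insertPerm_symm_zero]
    refine Prod.ext rfl (Equiv.ext fun i => Fin.succ_injective _ ?_)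
    rw [← insertPerm_succAbove, h, insertPerm_succAbove]
  · simp [Fintype.card_perm, Nat.factorial_succ]

lemma sum_perm_succ {M : Type*} [AddCommMonoid M] {n : ℕ} (F : Equiv.Perm (Fin (n + 1)) → M) :
    ∑ σ, F σ = ∑ c, ∑ σ, F (insertPerm c σ) := by
  rw [← Fintype.sum_prod_type', ← (insertPerm_bijective n).sum_comp F]

/-- The permutation is monotone on the letters below `p` and on the letters from `p` on. -/
def IsShufflePerm (p : ℕ) {n : ℕ} (σ : Equiv.Perm (Fin n)) : Prop :=
  ∀ i j : Fin n, i < j → (((j : ℕ) < p) ∨ (p ≤ (i : ℕ))) → σ i < σ j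

lemma isShufflePerm_insertPerm_zero (p : ℕ) {n : ℕ} (σ : Equiv.Perm (Fin n)) :
    IsShufflePerm (p + 1) (insertPerm 0 σ) ↔ IsShufflePerm p σ := by
  have h : ∀ i, insertPerm 0 σ (Fin.succ i) = (σ i).succ := by
    simpa using insertPerm_succAbove 0 σ
  constructor
  · intro hs i j hij hp
    simpa [h] using hs i.succ j.succ (by simpa) (by simpa using hp)
  · intro hs i j hij hp
    cases j using Fin.cases with
    | zero => simp at hij
    | succ j =>
      cases i using Fin.cases with
      | zero => simp [h, insertPerm_self]
      | succ i => simpa [h] using hs i j (by simpa using hij) (by simpa using hp)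

lemma isShufflePerm_insertPerm_self {n : ℕ} (c : Fin (n + 1)) (σ : Equiv.Perm (Fin n)) :
    IsShufflePerm c (insertPerm c σ) ↔ IsShufflePerm c σ := by
  have hlt : ∀ i : Fin n, ((c.succAbove i : Fin (n + 1)) : ℕ) < c ↔ (i : ℕ) < c := by
    intro i; simp only [Fin.succAbove, Fin.lt_def]; split_ifs <;> simp_all; omega
  have hle : ∀ i : Fin n, (c : ℕ) ≤ (c.succAbove i : Fin (n + 1)) ↔ (c : ℕ) ≤ i := by
    intro i; have := hlt i; omega
  constructor
  · intro hs i j hij hp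
    have := hs (c.succAbove i) (c.succAbove j) (by simpa) (by rwa [hlt, hle])
    simpa [insertPerm_succAbove] using this
  · intro hs i j hij hp
    obtain rfl | ⟨i, rfl⟩ := Fin.eq_self_or_eq_succAbove c i
    · obtain rfl | ⟨j, rfl⟩ := Fin.eq_self_or_eq_succAbove i j
      · simp at hij
      · simp [insertPerm_self, insertPerm_succAbove]
    · obtain rfl | ⟨j, rfl⟩ := Fin.eq_self_or_eq_succAbove c j
      · rw [Fin.lt_def] at hij; omega
      · rw [hlt, hle] at hp
        simpa [insertPerm_succAbove] using hs i j (by simpa using hij) hp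

lemma IsShufflePerm.eq_zero_or_eq {p n : ℕ} {c : Fin (n + 1)} {σ : Equiv.Perm (Fin n)}
    (h : IsShufflePerm p (insertPerm c σ)) : c = 0 ∧ 0 < p ∨ (c : ℕ) = p := by
  by_contra! hc
  rcases lt_or_ge (c : ℕ) p with hlt | hge
  · have h0 : (0 : Fin (n + 1)) < c := by
      rw [Fin.pos_iff_ne_zero]; rintro rfl; exact absurd (hc.1 rfl) (by simpa using hlt.ne')
    have := h 0 c h0 (Or.inl hlt)
    simp [insertPerm_self] at this
  · have hp : p < c := lt_of_le_of_ne hge (Ne.symm hc.2)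
    have := h ⟨p, hp.trans c.isLt⟩ c (by rwa [Fin.lt_def]) (Or.inr le_rfl)
    simp [insertPerm_self] at this

lemma IsShufflePerm.le_add {p n : ℕ} {σ : Equiv.Perm (Fin n)} (h : IsShufflePerm p σ)
    (i : Fin n) : (i : ℕ) ≤ p + σ i := by
  have key : ∀ m (hm : p + m < n), m ≤ σ ⟨p + m, hm⟩ := by
    intro m
    induction m with
    | zero => simp
    | succ m ih =>
      intro hm
      have h₁ := ih (by omega)
      have h₂ : (σ ⟨p + m, by omega⟩ : ℕ) < σ ⟨p + (m + 1), hm⟩ :=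
        h _ _ (by simp) (Or.inr (by simp))
      omega
  rcases le_or_gt p i with hp | hp
  · obtain ⟨m, hm⟩ := Nat.exists_eq_add_of_le hp
    have hk := key m (hm ▸ i.isLt)
    rw [show (⟨p + m, hm ▸ i.isLt⟩ : Fin n) = i from Fin.ext hm.symm] at hk
    omega
  · omega

/-- The word obtained by shuffling `ks` into `gs` along a permutation. -/
def permWord (gs ks : List K) {n : ℕ} (σ : Equiv.Perm (Fin n)) : List K :=
  List.ofFn fun j =>
    if (σ.symm j : ℕ) < gs.length then gs.getD (σ.symm j) 1
    else (gs.drop (gs.length + j - σ.symm j)).prod * ks.getD (σ.symm j - gs.length) 1 *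
      (gs.drop (gs.length + j - σ.symm j)).prod⁻¹

lemma permWord_insertPerm_zero (g : K) (gs ks : List K) {n : ℕ} (σ : Equiv.Perm (Fin n))
    (hσ : IsShufflePerm gs.length σ) :
    permWord (g :: gs) ks (insertPerm 0 σ) = g :: permWord gs ks σ := by
  rw [permWord, List.ofFn_succ]
  simp only [insertPerm_symm_zero, insertPerm_symm_succ]
  simp only [permWord]
  congr 2
  funext j
  by_cases h : (σ.symm j : ℕ) < gs.length
  · simp [h]
  · have h₁ : gs.length + 1 + (j + 1) - (σ.symm j + 1 : ℕ) =
        gs.length + j - (σ.symm j : ℕ) + 1 := by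
      have := hσ.le_add (σ.symm j)
      rw [Equiv.apply_symm_apply] at this
      omega
    simp [h, h₁]

lemma permWord_insertPerm_length (gs : List K) (k : K) (ks : List K) {n : ℕ} (c : Fin (n + 1))
    (hc : (c : ℕ) = gs.length) (σ : Equiv.Perm (Fin n)) :
    permWord gs (k :: ks) (insertPerm c σ) =
      (gs.prod * k * gs.prod⁻¹) :: permWord gs ks σ := by
  rw [permWord, List.ofFn_succ]
  simp only [insertPerm_symm_zero, insertPerm_symm_succ]
  simp only [permWord]
  congr 1
  · simp [hc]
  congr 1
  funext j
  by_cases h : (σ.symm j : ℕ) < gs.length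
  · simp [Fin.succAbove, Fin.lt_def, hc, h]
  · have h₁ : (σ.symm j : ℕ) + 1 - gs.length = (σ.symm j - gs.length) + 1 := by omega
    have h₂ : gs.length + (j + 1) - (σ.symm j + 1 : ℕ) = gs.length + j - (σ.symm j : ℕ) := by
      omega
    have h₃ : ¬(σ.symm j + 1 : ℕ) < gs.length := by omega
    simp [Fin.succAbove, Fin.lt_def, hc, h, h₁, h₂, h₃]

open scoped Classical in
/-- The signed sum of the shuffles of two words. -/
noncomputable def permSum (n : ℕ) (gs ks : List K) : List K →₀ ℤ :=
  ∑ σ : Equiv.Perm (Fin n), if IsShufflePerm gs.length σ then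
    ((Equiv.Perm.sign σ : ℤˣ) : ℤ) • Finsupp.single (permWord gs ks σ) 1 else 0

open scoped Classical in
/-- Split the sum over shuffles by the letter that is placed first. -/
lemma permSum_succ (n : ℕ) (gs ks : List K) :
    permSum (n + 1) gs ks = ∑ c : Fin (n + 1), ∑ σ : Equiv.Perm (Fin n),
      if IsShufflePerm gs.length (insertPerm c σ) then
        ((Equiv.Perm.sign (insertPerm c σ) : ℤˣ) : ℤ) •
          Finsupp.single (permWord gs ks (insertPerm c σ)) 1 else 0 :=
  sum_perm_succ _

open scoped Classical in
lemma sum_insertPerm_zero (n : ℕ) (g : K) (gs ks : List K) :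
    (∑ σ : Equiv.Perm (Fin n), if IsShufflePerm (g :: gs).length (insertPerm 0 σ) then
      ((Equiv.Perm.sign (insertPerm 0 σ) : ℤˣ) : ℤ) •
        Finsupp.single (permWord (g :: gs) ks (insertPerm 0 σ)) (1 : ℤ) else 0) =
      consL g (permSum n gs ks) := by
  rw [permSum, map_sum]
  refine Finset.sum_congr rfl fun σ _ => ?_
  rw [List.length_cons, isShufflePerm_insertPerm_zero]
  split_ifs with h
  · rw [permWord_insertPerm_zero _ _ _ _ h, sign_insertPerm, map_zsmul, consL_single]
    simp
  · simp

open scoped Classical in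
lemma sum_insertPerm_length (n : ℕ) (gs : List K) (k : K) (ks : List K) (c : Fin (n + 1))
    (hc : (c : ℕ) = gs.length) :
    (∑ σ : Equiv.Perm (Fin n), if IsShufflePerm gs.length (insertPerm c σ) then
      ((Equiv.Perm.sign (insertPerm c σ) : ℤˣ) : ℤ) •
        Finsupp.single (permWord gs (k :: ks) (insertPerm c σ)) (1 : ℤ) else 0) =
      (-1 : ℤ) ^ gs.length • consL (gs.prod * k * gs.prod⁻¹) (permSum n gs ks) := by
  rw [permSum, map_sum, Finset.smul_sum]
  refine Finset.sum_congr rfl fun σ _ => ?_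
  rw [permWord_insertPerm_length _ _ _ _ hc, sign_insertPerm, ← hc,
    isShufflePerm_insertPerm_self]
  split_ifs with h
  · rw [map_zsmul, consL_single, mul_smul]
  · simp

lemma permSum_nil_cons (n : ℕ) (k : K) (ks : List K) :
    permSum (n + 1) [] (k :: ks) = consL k (permSum n [] ks) := by
  rw [permSum_succ, Finset.sum_eq_single 0, sum_insertPerm_length _ _ _ _ _ (by simp)]
  · simp
  · intro c _ hc
    refine Finset.sum_eq_zero fun σ _ => if_neg fun h => ?_
    rcases h.eq_zero_or_eq with h | h
    · exact hc h.1
    · exact hc (Fin.ext (by simpa using h))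
  · simp

lemma permSum_cons_nil (n : ℕ) (g : K) (gs : List K) (hn : n = gs.length) :
    permSum (n + 1) (g :: gs) [] = consL g (permSum n gs []) := by
  rw [permSum_succ, Finset.sum_eq_single 0, sum_insertPerm_zero]
  · intro c _ hc
    refine Finset.sum_eq_zero fun σ _ => if_neg fun h => ?_
    rcases h.eq_zero_or_eq with h | h
    · exact hc h.1
    · have := c.isLt
      simp only [List.length_cons] at h
      omega
  · simp

lemma permSum_cons_cons (n : ℕ) (g : K) (gs : List K) (k : K) (ks : List K)
    (hn : gs.length < n) :
    permSum (n + 1) (g :: gs) (k :: ks) = consL g (permSum n gs (k :: ks)) +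
      (-1 : ℤ) ^ (gs.length + 1) •
        consL ((g :: gs).prod * k * (g :: gs).prod⁻¹) (permSum n (g :: gs) ks) := by
  have hne : (0 : Fin (n + 1)) ≠ ⟨gs.length + 1, by omega⟩ := by simp [Fin.ext_iff]
  rw [permSum_succ, Finset.sum_eq_add 0 ⟨gs.length + 1, by omega⟩ hne, sum_insertPerm_zero,
    sum_insertPerm_length _ _ _ _ _ (by simp)]
  · simp
  · intro c _ hc
    refine Finset.sum_eq_zero fun σ _ => if_neg fun h => ?_
    rcases h.eq_zero_or_eq with h | h
    · exact hc.1 h.1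
    · exact hc.2 (Fin.ext (by simpa using h))
  · simp
  · simp

/-- Append a fixed word to every word of a chain. -/
noncomputable def appendL (w : List K) : (List K →₀ ℤ) →ₗ[ℤ] (List K →₀ ℤ) :=
  Finsupp.lmapDomain ℤ ℤ (· ++ w)

lemma appendL_single {α : Type} (w l : List α) (c : ℤ) :
    appendL w (Finsupp.single l c) = Finsupp.single (l ++ w) c := by
  simp [appendL]

lemma appendL_consL {α : Type} (a : α) (w : List α) (X : List α →₀ ℤ) :
    appendL w (consL a X) = consL a (appendL w X) := by
  have : appendL w ∘ₗ consL a = consL a ∘ₗ appendL w := by ext l : 2; simp [appendL_single]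
  exact LinearMap.congr_fun this X

/-- The recursive shuffle product is the signed sum over shuffle permutations. -/
theorem shuffleWord_append_singleton (n : ℕ) (gs ks : List K) (g k : K)
    (hn : n = gs.length + ks.length) :
    shuffleWord (gs ++ [g]) (ks ++ [k]) = appendL [g * k]
      (permSum n gs (ks.map fun x => g * x * g⁻¹)) := by
  induction n generalizing gs ks with
  | zero =>
    obtain ⟨rfl, rfl⟩ : gs = [] ∧ ks = [] := by
      simpa [List.length_eq_zero_iff, eq_comm] using hn
    have h : ∀ σ : Equiv.Perm (Fin 0), IsShufflePerm 0 σ := fun σ i => i.elim0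
    simp [shuffleWord_cons_cons, permSum, h, permWord, appendL_single]
  | succ n ih =>
    match gs, ks with
    | [], [] => simp at hn
    | [], k' :: ks =>
      have := ih [] ks (by simpa using hn)
      simp only [List.nil_append] at this
      simp [shuffleWord_cons_cons, permSum_nil_cons, appendL_consL, this]
    | g' :: gs, [] =>
      have := ih gs [] (by simpa using hn)
      simp only [List.nil_append] at this
      simp [shuffleWord_cons_cons, permSum_cons_nil n g' gs (by simpa using hn),
        appendL_consL, this]
    | g' :: gs, k' :: ks =>
      have h₁ := ih gs (k' :: ks) (by simp at hn ⊢; omega)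
      have h₂ := ih (g' :: gs) ks (by simp at hn ⊢; omega)
      simp only [List.cons_append, List.map_cons] at h₁ h₂ ⊢
      rw [permSum_cons_cons _ _ _ _ _ (by simp at hn; omega), shuffleWord_cons_cons, h₁, h₂]
      simp [appendL_consL, mul_assoc]

lemma ofFn_shuffleTuple (p q : ℕ) (σ : Equiv.Perm (Fin (p + q))) (gs : Fin p → K)
    (ks : Fin q → K) :
    List.ofFn (shuffleTuple K p q σ gs ks) = permWord (List.ofFn gs) (List.ofFn ks) σ := by
  rw [permWord]
  congr 1
  funext j
  have := (σ.symm j).isLt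
  by_cases h : (σ.symm j : ℕ) < p
  · simp [shuffleTuple, h]
  · have h' : (σ.symm j : ℕ) - p < q := by omega
    simp [shuffleTuple, h, h', prefixProd]

lemma toWords_tauBar (p q : ℕ) (gs : Fin p → K) (ks : Fin q → K) :
    toWords _ (tauBar K p q gs ks) = permSum (p + q) (List.ofFn gs) (List.ofFn ks) := by
  classical
  simp only [tauBar, permSum, map_sum, map_zsmul, toWords_single, ofFn_shuffleTuple]
  rw [← Finset.sum_filter, List.length_ofFn]
  rfl

lemma toWords_tauGen {p q : ℕ} (x : (Fin (p + 1) → K) × (Fin (q + 1) → K)) :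
    toWords _ (tauGen K x) = shuffleWord (List.ofFn x.1) (List.ofFn x.2) := by
  have h : ∀ (a : K) (c : (Fin (p + q) → K) →₀ ℤ),
      toWords _ (Finsupp.mapDomain (fun t => (Fin.snoc t a : Fin (p + q + 1) → K)) c) =
        appendL [a] (toWords _ c) := by
    intro a c
    simp only [toWords, appendL, Finsupp.lmapDomain_apply, ← Finsupp.mapDomain_comp]
    congr 1
    funext t
    simp [List.ofFn_succ' (Fin.snoc t a : Fin (p + q + 1) → K), -List.ofFn_succ]
  rw [tauGen, h, toWords_tauBar, List.ofFn_succ' x.1, List.ofFn_succ' x.2, List.concat_eq_append,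
    List.concat_eq_append, shuffleWord_append_singleton (p + q) _ _ _ _ (by simp), List.map_ofFn]
  rfl

lemma toWords_chCast {α : Type} {m m' : ℕ} (h : m = m') (x : Ch α m) :
    toWords _ (chCast α h x) = toWords _ x := by
  subst h
  exact congrArg _ Finsupp.mapDomain_id

lemma toWords_tauCh (n : ℕ) (y : TotCh K n) :
    toWords _ (tauCh K n y) = Finsupp.linearCombination ℤ
      (fun s : Σ p : Fin (n + 1), (Fin ((p : ℕ) + 1) → K) × (Fin ((n - (p : ℕ)) + 1) → K) =>
        shuffleWord (List.ofFn s.2.1) (List.ofFn s.2.2)) y := by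
  induction y using Finsupp.induction_linear with
  | zero => simp
  | add f g hf hg => simp only [map_add, hf, hg]
  | single s a => simp [tauCh, toWords_chCast, toWords_tauGen]

lemma ofFn_comp_cast {α : Type} {m m' : ℕ} (h : m = m') (t : Fin m' → α) :
    (List.ofFn fun j => t (Fin.cast h j)) = List.ofFn t := by
  subst h; rfl

lemma linearCombination_shuffleWord_left {m : ℕ} (Q : List K) (c : (Fin m → K) →₀ ℤ) :
    Finsupp.linearCombination ℤ (fun t => shuffleWord (List.ofFn t) Q) c =
      shuffleLeft Q (toWords _ c) := by
  rw [shuffleLeft, toWords, Finsupp.lmapDomain_apply, Finsupp.linearCombination_mapDomain]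
  rfl

lemma linearCombination_shuffleWord_right {m : ℕ} (G : List K) (c : (Fin m → K) →₀ ℤ) :
    Finsupp.linearCombination ℤ (fun t => shuffleWord G (List.ofFn t)) c =
      shuffleRight G (toWords _ c) := by
  rw [shuffleRight, toWords, Finsupp.lmapDomain_apply, Finsupp.linearCombination_mapDomain]
  rfl

lemma barL_single_of_length_eq_one {l : List K} (h : l.length = 1) :
    barL (Finsupp.single l 1) = Finsupp.single [] 1 := by
  obtain ⟨a, rfl⟩ := List.length_eq_one_iff.mp h
  simp [barL, mergesWord, mergeWord]

lemma toWords_tauCh_totDgen {n : ℕ}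
    (x : Σ p : Fin (n + 2), (Fin ((p : ℕ) + 1) → K) × (Fin ((n + 1 - (p : ℕ)) + 1) → K)) :
    toWords _ (tauCh K n (totDgen K x)) =
      shuffleLeft (List.ofFn x.2.2) (barL (Finsupp.single (List.ofFn x.2.1) 1)) +
        (-1 : ℤ) ^ (x.1 : ℕ) •
          shuffleRight (List.ofFn x.2.1) (barL (Finsupp.single (List.ofFn x.2.2) 1)) := by
  rw [toWords_tauCh, totDgen, map_add]
  congr 1
  · split_ifs with hp
    · rw [Finsupp.linearCombination_mapDomain]
      simp only [Function.comp_def, ofFn_comp_cast]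
      rw [linearCombination_shuffleWord_left, toWords_barDgen, ofFn_comp_cast]
    · rw [barL_single_of_length_eq_one (by rw [List.length_ofFn]; omega)]
      simp
  · split_ifs with hq
    · rw [map_zsmul, Finsupp.linearCombination_mapDomain]
      simp only [Function.comp_def]
      rw [linearCombination_shuffleWord_right, toWords_barDgen, ofFn_comp_cast]
    · rw [barL_single_of_length_eq_one (by rw [List.length_ofFn]; omega)]
      simp

end ListModel

/-- The shuffle homomorphism
`τ : Tot_*(C_*(EK,ℤ) ⊗_ℤ C_*(EK,ℤ)) → C_*(EK,ℤ)` is a chain map. -/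
theorem stmt_7 : ∀ (n : ℕ) (x : TotCh K (n + 1)),
    barD K n (tauCh K (n + 1) x) = tauCh K n (totD K n x) := by
  intro n x
  apply toWords_injective
  rw [toWords_barD]
  induction x using Finsupp.induction_linear with
  | zero => simp
  | add f g hf hg => simp only [map_add, hf, hg]
  | single s a =>
    have ha : Finsupp.single s a = a • Finsupp.single s (1 : ℤ) := by simp
    have hs : totD K n (Finsupp.single s 1) = totDgen K s := by simp [totD]
    rw [ha]
    simp only [map_zsmul]
    congr 1
    have hlt := s.1.isLt
    rw [hs, toWords_tauCh_totDgen, toWords_tauCh, Finsupp.linearCombination_single, one_smul,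
      barL_shuffleWord _ _ (by simp) (by simp)
        (by rw [List.length_ofFn, List.length_ofFn]; omega)]
    simp [pow_succ]

end Stmt7
end

section
/- For K acting on itself by conjugation, the map H^p(K,ℤ) ⊕ H^p(Tot^*(B^{*,*}(K ⋊ K, ℤ))) → H^p(Tot^*(A^{*,*}(K ⋊ K, ℤ))), (x, y) ↦ τ₁*x + y, is an isomorphism for all p > 0. -/
set_option linter.unusedSectionVars false

namespace Stmt10

/-- Merge the entries at positions `i` and `i+1` of a tuple. -/
def mergeD {α : Type} [Mul α] {n : ℕ} (i : ℕ) (h : Fin (n + 1) → α) : Fin n → α :=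
  fun j =>
    if (j : ℕ) < i then h j.castSucc
    else if (j : ℕ) = i then h j.castSucc * h j.succ
    else h j.succ

variable (G K : Type) [Group G] [Group K] (ρ : G →* MulAut K)
variable (M : Type) [AddCommGroup M]

/-- The `(p,q)` group of the double bar cochain complex: maps `G^p × K^q → M`. -/
abbrev Cpq (p q : ℕ) : Type := ((Fin p → G) × (Fin q → K)) → M

/-- The differential `δ_G : C^{p,q} → C^{p+1,q}`. -/
def dGfun {p q : ℕ} (F : Cpq G K M p q) : Cpq G K M (p + 1) q := fun x =>
  F (fun j => x.1 j.succ, x.2) +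
    ∑ i ∈ Finset.range p, ((-1 : ℤ) ^ (i + 1)) • F (mergeD i x.1, x.2) +
    ((-1 : ℤ) ^ (p + 1)) •
      F (fun j => x.1 j.castSucc, fun j => ρ (x.1 (Fin.last p)) (x.2 j))

/-- The differential `δ_K : C^{p,q} → C^{p,q+1}`. -/
def dKfun {p q : ℕ} (F : Cpq G K M p q) : Cpq G K M p (q + 1) := fun x =>
  F (x.1, fun j => x.2 j.succ) +
    ∑ i ∈ Finset.range q, ((-1 : ℤ) ^ (i + 1)) • F (x.1, mergeD i x.2) +
    ((-1 : ℤ) ^ (q + 1)) • F (x.1, fun j => x.2 j.castSucc)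

lemma dGfun_add {p q : ℕ} (F F' : Cpq G K M p q) :
    dGfun G K ρ M (F + F') = dGfun G K ρ M F + dGfun G K ρ M F' := by
  funext x
  simp only [dGfun, Pi.add_apply, smul_add, Finset.sum_add_distrib]
  abel

lemma dKfun_add {p q : ℕ} (F F' : Cpq G K M p q) :
    dKfun G K M (F + F') = dKfun G K M F + dKfun G K M F' := by
  funext x
  simp only [dKfun, Pi.add_apply, smul_add, Finset.sum_add_distrib]
  abel

/-- `δ_G` as an additive homomorphism. -/
def dGhom (p q : ℕ) : Cpq G K M p q →+ Cpq G K M (p + 1) q :=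
  AddMonoidHom.mk' (dGfun G K ρ M) (dGfun_add G K ρ M)

/-- `δ_K` as an additive homomorphism. -/
def dKhom (p q : ℕ) : Cpq G K M p q →+ Cpq G K M p (q + 1) :=
  AddMonoidHom.mk' (dKfun G K M) (dKfun_add G K M)

/-- Reindexing of bidegrees. -/
def castC {p q p' q' : ℕ} (h1 : p = p') (h2 : q = q') (F : Cpq G K M p q) :
    Cpq G K M p' q' :=
  fun x => F (fun i => x.1 (Fin.cast h1 i), fun i => x.2 (Fin.cast h2 i))

lemma castC_add {p q p' q' : ℕ} (h1 : p = p') (h2 : q = q') (F F' : Cpq G K M p q) :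
    castC G K M h1 h2 (F + F') = castC G K M h1 h2 F + castC G K M h1 h2 F' := rfl

/-- The subgroup of normalized cochains. -/
def nrm (p q : ℕ) : AddSubgroup (Cpq G K M p q) where
  carrier := {F | ∀ x, ((∃ i, x.1 i = 1) ∨ (∃ i, x.2 i = 1)) → F x = 0}
  add_mem' := by
    intro a b ha hb x hx
    simp only [Pi.add_apply, ha x hx, hb x hx, add_zero]
  zero_mem' := by intro x _; rfl
  neg_mem' := by
    intro a ha x hx
    simp only [Pi.neg_apply, ha x hx, neg_zero]

/-- Degree `n` of the total complex of the full double complex `C^{*,*}`. -/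
abbrev TotC (n : ℕ) : Type := ∀ p : Fin (n + 1), Cpq G K M (p : ℕ) (n - (p : ℕ))

/-- Degree `n` of the total complex of `A^{*,*} = C^{*,*>0}` (0-th row removed). -/
abbrev TotA (n : ℕ) : Type := ∀ p : Fin n, Cpq G K M (p : ℕ) (n - (p : ℕ))

/-- Degree `n` of the total complex of `B^{*,*} = C^{*>0,*>0}` (0-th row and column
removed); the component indexed by `p : Fin (n-1)` has bidegree `(p+1, n-(p+1))`. -/
abbrev TotB (n : ℕ) : Type := ∀ p : Fin (n - 1), Cpq G K M ((p : ℕ) + 1) (n - ((p : ℕ) + 1))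

/-- The total differential `δ_G ⊕ (-1)^p δ_K` of `C^{*,*}`, as a function. -/
def totdFun {n : ℕ} (x : TotC G K M n) : TotC G K M (n + 1) := fun p =>
  (if h1 : 1 ≤ (p : ℕ) then
    castC G K M (by omega)
      (by
        show n - ((p : ℕ) - 1) = n + 1 - (p : ℕ)
        have := p.isLt; omega)
      (dGhom G K ρ M ((p : ℕ) - 1) (n - ((p : ℕ) - 1))
        (x ⟨(p : ℕ) - 1, by have := p.isLt; omega⟩))
  else 0) +
  ((-1 : ℤ) ^ (p : ℕ)) •
  (if h2 : (p : ℕ) ≤ n then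
    castC G K M rfl (by omega)
      (dKhom G K M (p : ℕ) (n - (p : ℕ)) (x ⟨(p : ℕ), by omega⟩))
  else 0)

lemma totdFun_add {n : ℕ} (x y : TotC G K M n) :
    totdFun G K ρ M (x + y) = totdFun G K ρ M x + totdFun G K ρ M y := by
  funext p
  by_cases h1 : 1 ≤ (p : ℕ) <;> by_cases h2 : (p : ℕ) ≤ n <;>
    simp only [totdFun, Pi.add_apply, dif_pos, dif_neg, h1, h2, map_add, castC_add,
      smul_add, add_zero, smul_zero, not_true, not_false_iff] <;> abel

/-- The total differential of `C^{*,*}` as an additive homomorphism. -/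
def totd (n : ℕ) : TotC G K M n →+ TotC G K M (n + 1) :=
  AddMonoidHom.mk' (totdFun G K ρ M) (totdFun_add G K ρ M)

/-- The total differential of `A^{*,*}`, as a function. -/
def totdAFun {n : ℕ} (x : TotA G K M n) : TotA G K M (n + 1) := fun p =>
  (if h1 : 1 ≤ (p : ℕ) then
    castC G K M (by omega)
      (by
        show n - ((p : ℕ) - 1) = n + 1 - (p : ℕ)
        have := p.isLt; omega)
      (dGhom G K ρ M ((p : ℕ) - 1) (n - ((p : ℕ) - 1))
        (x ⟨(p : ℕ) - 1, by have := p.isLt; omega⟩))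
  else 0) +
  ((-1 : ℤ) ^ (p : ℕ)) •
  (if h2 : (p : ℕ) < n then
    castC G K M rfl (by omega)
      (dKhom G K M (p : ℕ) (n - (p : ℕ)) (x ⟨(p : ℕ), h2⟩))
  else 0)

lemma totdAFun_add {n : ℕ} (x y : TotA G K M n) :
    totdAFun G K ρ M (x + y) = totdAFun G K ρ M x + totdAFun G K ρ M y := by
  funext p
  by_cases h1 : 1 ≤ (p : ℕ) <;> by_cases h2 : (p : ℕ) < n <;>
    simp only [totdAFun, Pi.add_apply, dif_pos, dif_neg, h1, h2, map_add, castC_add,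
      smul_add, add_zero, smul_zero, not_true, not_false_iff] <;> abel

/-- The total differential of `A^{*,*}` as an additive homomorphism. -/
def totdA (n : ℕ) : TotA G K M n →+ TotA G K M (n + 1) :=
  AddMonoidHom.mk' (totdAFun G K ρ M) (totdAFun_add G K ρ M)

/-- The total differential of `B^{*,*}`, as a function. -/
def totdBFun {n : ℕ} (x : TotB G K M n) : TotB G K M (n + 1) := fun p =>
  (if h1 : 1 ≤ (p : ℕ) then
    castC G K M (by omega)
      (by
        show n - (((p : ℕ) - 1) + 1) = n + 1 - ((p : ℕ) + 1)
        have := p.isLt; omega)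
      (dGhom G K ρ M (((p : ℕ) - 1) + 1) (n - (((p : ℕ) - 1) + 1))
        (x ⟨(p : ℕ) - 1, by have := p.isLt; omega⟩))
  else 0) +
  ((-1 : ℤ) ^ ((p : ℕ) + 1)) •
  (if h2 : (p : ℕ) < n - 1 then
    castC G K M rfl (by omega)
      (dKhom G K M ((p : ℕ) + 1) (n - ((p : ℕ) + 1)) (x ⟨(p : ℕ), h2⟩))
  else 0)

lemma totdBFun_add {n : ℕ} (x y : TotB G K M n) :
    totdBFun G K ρ M (x + y) = totdBFun G K ρ M x + totdBFun G K ρ M y := by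
  funext p
  by_cases h1 : 1 ≤ (p : ℕ) <;> by_cases h2 : (p : ℕ) < n - 1 <;>
    simp only [totdBFun, Pi.add_apply, dif_pos, dif_neg, h1, h2, map_add, castC_add,
      smul_add, add_zero, smul_zero, not_true, not_false_iff] <;> abel

/-- The total differential of `B^{*,*}` as an additive homomorphism. -/
def totdB (n : ℕ) : TotB G K M n →+ TotB G K M (n + 1) :=
  AddMonoidHom.mk' (totdBFun G K ρ M) (totdBFun_add G K ρ M)

/-- Normalized elements of the total complex of `C^{*,*}`. -/
def nrmC (n : ℕ) : AddSubgroup (TotC G K M n) :=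
  AddSubgroup.pi Set.univ fun p => nrm G K M (p : ℕ) (n - (p : ℕ))

/-- Normalized elements of the total complex of `A^{*,*}`. -/
def nrmA (n : ℕ) : AddSubgroup (TotA G K M n) :=
  AddSubgroup.pi Set.univ fun p => nrm G K M (p : ℕ) (n - (p : ℕ))

/-- Normalized elements of the total complex of `B^{*,*}`. -/
def nrmB (n : ℕ) : AddSubgroup (TotB G K M n) :=
  AddSubgroup.pi Set.univ fun p => nrm G K M ((p : ℕ) + 1) (n - ((p : ℕ) + 1))

/-- Normalized cocycles of `Tot^n(C^{*,*})`. -/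
def ZC (n : ℕ) : AddSubgroup (TotC G K M n) := nrmC G K M n ⊓ (totd G K ρ M n).ker

/-- Normalized coboundaries of `Tot^n(C^{*,*})`. -/
def BC : ∀ n : ℕ, AddSubgroup (TotC G K M n)
  | 0 => ⊥
  | n + 1 => AddSubgroup.map (totd G K ρ M n) (nrmC G K M n)

/-- The degree `n` cohomology of `Tot^*(C^{*,*}(K ⋊ G, M))`. -/
abbrev HC (n : ℕ) :=
  ZC G K ρ M n ⧸ (BC G K ρ M n).addSubgroupOf (ZC G K ρ M n)


/-- Normalized cocycles of `Tot^n(A^{*,*})`. -/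
def ZA (n : ℕ) : AddSubgroup (TotA G K M n) := nrmA G K M n ⊓ (totdA G K ρ M n).ker

/-- Normalized coboundaries of `Tot^n(A^{*,*})`. -/
def BA : ∀ n : ℕ, AddSubgroup (TotA G K M n)
  | 0 => ⊥
  | n + 1 => AddSubgroup.map (totdA G K ρ M n) (nrmA G K M n)

/-- The degree `n` cohomology of `Tot^*(A^{*,*}(K ⋊ G, M))`. -/
abbrev HA (n : ℕ) :=
  ZA G K ρ M n ⧸ (BA G K ρ M n).addSubgroupOf (ZA G K ρ M n)


/-- Normalized cocycles of `Tot^n(B^{*,*})`. -/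
def ZB (n : ℕ) : AddSubgroup (TotB G K M n) := nrmB G K M n ⊓ (totdB G K ρ M n).ker

/-- Normalized coboundaries of `Tot^n(B^{*,*})`. -/
def BB : ∀ n : ℕ, AddSubgroup (TotB G K M n)
  | 0 => ⊥
  | n + 1 => AddSubgroup.map (totdB G K ρ M n) (nrmB G K M n)

/-- The degree `n` cohomology of `Tot^*(B^{*,*}(K ⋊ G, M))`. -/
abbrev HB (n : ℕ) :=
  ZB G K ρ M n ⧸ (BB G K ρ M n).addSubgroupOf (ZB G K ρ M n)



/-- A `(p,q)`-shuffle: a permutation of `Fin (p+q)` monotone on the first `p` and the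
last `q` letters. -/
def IsShuffle (p q : ℕ) (σ : Equiv.Perm (Fin (p + q))) : Prop :=
  ∀ i j : Fin (p + q), i < j → (((j : ℕ) < p) ∨ (p ≤ (i : ℕ))) → σ i < σ j

/-- Product `g_d ⋯ g_{p-1}` of a tail of a tuple. -/
def prefixProd {p : ℕ} (gs : Fin p → K) (d : ℕ) : K := ((List.ofFn gs).drop d).prod

/-- The tuple `λ[g₁|…|g_p|k₁|…|k_q]` associated to a `(p,q)`-shuffle `λ`:
`s_{λ(i)} = gᵢ` for `i ≤ p` and
`s_{λ(i)} = (g_{p+λ(i)-i+1}⋯g_p)·k_{i-p}·(g_{p+λ(i)-i+1}⋯g_p)⁻¹` for `i > p`. -/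
def shuffleTuple (p q : ℕ) (σ : Equiv.Perm (Fin (p + q))) (gs : Fin p → K)
    (ks : Fin q → K) : Fin (p + q) → K :=
  fun j =>
    if h : ((σ.symm j : Fin (p + q)) : ℕ) < p then gs ⟨(σ.symm j : Fin (p + q)), h⟩
    else
      prefixProd K gs (p + (j : ℕ) - ((σ.symm j : Fin (p + q)) : ℕ)) *
        ks ⟨((σ.symm j : Fin (p + q)) : ℕ) - p, by
          have := (σ.symm j).isLt; omega⟩ *
        (prefixProd K gs (p + (j : ℕ) - ((σ.symm j : Fin (p + q)) : ℕ)))⁻¹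

open scoped Classical in
/-- `τ[g₁|…|g_p‖k₁|…|k_q] = Σ_{λ ∈ Shuff(p,q)} (-1)^|λ| λ[g₁|…|g_p|k₁|…|k_q]`
as a formal `ℤ`-linear combination of `(p+q)`-tuples. -/
noncomputable def tauBar (p q : ℕ) (gs : Fin p → K) (ks : Fin q → K) :
    ((Fin (p + q) → K) →₀ ℤ) :=
  ∑ σ ∈ Finset.univ.filter (fun σ => IsShuffle p q σ),
    (((Equiv.Perm.sign σ : ℤˣ) : ℤ)) • Finsupp.single (shuffleTuple K p q σ gs ks) 1

/-- Normalized bar `n`-cochains of `K` with coefficients in `M`, realized as the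
bidegree `(n,0)` part. -/
abbrev SC (n : ℕ) : Type := Cpq K K M n 0

/-- Normalized cocycles of the bar cochain complex of `K`. -/
def ZS (n : ℕ) : AddSubgroup (SC K M n) :=
  nrm K K M n 0 ⊓ (dGhom K K MulAut.conj M n 0).ker

/-- Normalized coboundaries of the bar cochain complex of `K`. -/
def BS : ∀ n : ℕ, AddSubgroup (SC K M n)
  | 0 => ⊥
  | n + 1 => AddSubgroup.map (dGhom K K MulAut.conj M n 0) (nrm K K M n 0)

/-- Normalized bar cohomology of `K`. -/
abbrev HS (n : ℕ) := ZS K M n ⧸ (BS K M n).addSubgroupOf (ZS K M n)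


/-- The restricted dual shuffle homomorphism `τ₁∨`, landing in
`Tot^n(A^{*,*}(K ⋊ K, M))` (components with `q > 0`). -/
noncomputable def tauDualA (n : ℕ) (F : SC K M n) : TotA K K M n := fun p x =>
  (tauBar K (p : ℕ) (n - (p : ℕ)) x.1 x.2).sum fun t c =>
    c • F (fun j => t (Fin.cast (by have := p.isLt; omega) j), fun i => i.elim0)

/-- The inclusion `Tot^n(B^{*,*}) → Tot^n(A^{*,*})`. -/
def inclBA (n : ℕ) (b : TotB K K M n) : TotA K K M n := fun p =>
  if h : 1 ≤ (p : ℕ) then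
    castC K K M
      (by
        show ((p : ℕ) - 1) + 1 = (p : ℕ)
        omega)
      (by
        show n - (((p : ℕ) - 1) + 1) = n - (p : ℕ)
        omega)
      (b ⟨(p : ℕ) - 1, by have := p.isLt; omega⟩)
  else 0

section Lists

variable {K M}

/-- The signed sum of the values of `f` over all shuffles of the lists `gs` and `ks`, where an
entry of `ks` is conjugated by the product of the entries of `gs` placed to its right. -/
def shuf : List K → List K → (List K → M) → M
  | [], ks, f => f ks
  | g :: gs, [], f => f (g :: gs)
  | g :: gs, k :: ks, f =>
    shuf gs (k :: ks) (fun l => f (g :: l)) +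
      ((-1 : ℤ) ^ (gs.length + 1)) •
        shuf (g :: gs) ks (fun l => f (MulAut.conj (g :: gs).prod k :: l))
termination_by gs ks => gs.length + ks.length

/-- The alternating sum of all faces but the first in the `G`-direction of the double bar
complex; the last face acts on the second list by conjugation. -/
def dTail : List K → List K → (List K → List K → M) → M
  | [], _, _ => 0
  | [g], ks, Φ => -Φ [] (ks.map (MulAut.conj g))
  | g :: g' :: gs, ks, Φ => -Φ (g * g' :: gs) ks - dTail (g' :: gs) ks (fun l => Φ (g :: l))

lemma shuf_nil_right (gs : List K) (f : List K → M) : shuf gs [] f = f gs := by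
  cases gs <;> simp [shuf]

lemma shuf_congr {gs ks : List K} {f f' : List K → M}
    (h : ∀ l : List K, l.length = gs.length + ks.length → f l = f' l) :
    shuf gs ks f = shuf gs ks f' := by
  induction gs, ks, f using shuf.induct generalizing f' with
  | case1 ks f => simpa [shuf] using h ks (by simp)
  | case2 g gs f => simpa [shuf] using h (g :: gs) (by simp)
  | case3 g gs k ks f ih₁ ih₂ =>
    rw [shuf, shuf, ih₁ (f' := fun l => f' (g :: l)), ih₂]
    · intro l hl
      exact h _ (by simp at hl ⊢; omega)
    · intro l hl
      exact h _ (by simp at hl ⊢; omega)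

lemma shuf_add (gs ks : List K) (f f' : List K → M) :
    shuf gs ks (fun l => f l + f' l) = shuf gs ks f + shuf gs ks f' := by
  induction gs, ks, f using shuf.induct generalizing f' with
  | case1 ks f => simp [shuf]
  | case2 g gs f => simp [shuf]
  | case3 g gs k ks f ih₁ ih₂ =>
    rw [shuf, ih₁, ih₂, shuf, shuf]
    module

lemma shuf_neg (gs ks : List K) (f : List K → M) :
    shuf gs ks (fun l => -f l) = -shuf gs ks f := by
  induction gs, ks, f using shuf.induct with
  | case1 ks f => simp [shuf]
  | case2 g gs f => simp [shuf]
  | case3 g gs k ks f ih₁ ih₂ =>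
    rw [shuf, ih₁, ih₂, shuf]
    module

lemma shuf_sub (gs ks : List K) (f f' : List K → M) :
    shuf gs ks (fun l => f l - f' l) = shuf gs ks f - shuf gs ks f' := by
  simp only [sub_eq_add_neg, shuf_add, shuf_neg]

/-- Shuffle sums preserve normalized cochains. -/
lemma shuf_eq_zero {gs ks : List K} {f : List K → M}
    (h : ∀ l : List K, l.length = gs.length + ks.length → 1 ∈ l → f l = 0)
    (h1 : 1 ∈ gs ∨ 1 ∈ ks) : shuf gs ks f = 0 := by
  have shuf_zero : ∀ gs ks : List K, shuf gs ks (fun _ => (0 : M)) = 0 := by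
    intro gs ks
    simpa using shuf_sub gs ks (fun _ => (0 : M)) (fun _ => 0)
  induction gs, ks, f using shuf.induct with
  | case1 ks f => simpa [shuf] using h ks (by simp) (by simpa using h1)
  | case2 g gs f => simpa [shuf] using h (g :: gs) (by simp) (by simpa using h1)
  | case3 g gs k ks f ih₁ ih₂ =>
    have e₁ : shuf gs (k :: ks) (fun l => f (g :: l)) = 0 := by
      by_cases hg : g = 1
      · rw [shuf_congr (f' := fun _ => 0), shuf_zero]
        intro l hl
        exact h _ (by simp at hl ⊢; omega) (by simp [hg])
      · apply ih₁
        · intro l hl hl1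
          exact h _ (by simp at hl ⊢; omega) (by simp [hl1])
        · simpa [Ne.symm hg] using h1
    have e₂ : shuf (g :: gs) ks (fun l => f (MulAut.conj (g :: gs).prod k :: l)) = 0 := by
      by_cases hk : k = 1
      · rw [shuf_congr (f' := fun _ => 0), shuf_zero]
        intro l hl
        exact h _ (by simp at hl ⊢; omega) (by simp [hk])
      · apply ih₂
        · intro l hl hl1
          exact h _ (by simp at hl ⊢; omega) (by simp [hl1])
        · simpa [Ne.symm hk] using h1
    rw [shuf, e₁, e₂, smul_zero, add_zero]

lemma map_conj_one (ks : List K) : ks.map (MulAut.conj (1 : K)) = ks := by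
  simp

lemma dTail_congr {gs ks : List K} {Φ Ψ : List K → List K → M}
    (h : ∀ (l : List K) (a : K), l.length + 1 = gs.length → l.prod * a = gs.prod →
      Φ l (ks.map (MulAut.conj a)) = Ψ l (ks.map (MulAut.conj a))) :
    dTail gs ks Φ = dTail gs ks Ψ := by
  induction gs, ks, Φ using dTail.induct generalizing Ψ with
  | case1 => simp [dTail]
  | case2 g ks Φ => rw [dTail, dTail, h [] g (by simp) (by simp)]
  | case3 g g' gs ks Φ ih =>
    have h1 := h (g * g' :: gs) 1 (by simp) (by simp [mul_assoc])
    rw [map_conj_one] at h1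
    rw [dTail, dTail, h1, ih (Ψ := fun l => Ψ (g :: l))]
    intro l a hl ha
    exact h (g :: l) a (by simpa using hl) (by simp [mul_assoc, ha])

lemma dTail_add (gs ks : List K) (Φ Ψ : List K → List K → M) :
    dTail gs ks (fun a b => Φ a b + Ψ a b) = dTail gs ks Φ + dTail gs ks Ψ := by
  induction gs, ks, Φ using dTail.induct generalizing Ψ with
  | case1 => simp [dTail]
  | case2 g ks Φ => simp only [dTail]; abel
  | case3 g g' gs ks Φ ih => simp only [dTail, ih]; abel

lemma dTail_zsmul (c : ℤ) (gs ks : List K) (Φ : List K → List K → M) :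
    dTail gs ks (fun a b => c • Φ a b) = c • dTail gs ks Φ := by
  induction gs, ks, Φ using dTail.induct with
  | case1 => simp [dTail]
  | case2 g ks Φ => simp only [dTail]; module
  | case3 g g' gs ks Φ ih => simp only [dTail, ih]; module

lemma dTail_tail (k : K) (gs ks : List K) (Φ : List K → List K → M) :
    dTail gs (k :: ks) (fun a b => Φ a b.tail) = dTail gs ks Φ := by
  induction gs, ks, Φ using dTail.induct with
  | case1 => simp [dTail]
  | case2 g ks Φ => simp [dTail]
  | case3 g g' gs ks Φ ih => simp only [dTail, ih, List.tail_cons]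

/-- The dual bar differential without the first face. -/
def dBar (f : List K → M) (l : List K) : M := dTail l [] (fun a _ => f a)

/-- Multiply the first entry of a list on the left. -/
def mulHead (g : K) : List K → List K
  | [] => []
  | h :: l => g * h :: l

lemma dBar_cons (f : List K → M) (g : K) (l : List K) :
    dBar f (g :: l) = -f (mulHead g l) - dBar (fun a => f (g :: a)) l := by
  cases l <;> simp [dBar, dTail, mulHead]

lemma dTail_const (gs ks : List K) (f : List K → M) :
    dTail gs ks (fun a _ => f a) = dBar f gs := by
  induction gs generalizing f with
  | nil => simp [dBar, dTail]
  | cons g gs ih =>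
    rw [dBar_cons, ← ih]
    cases gs <;> simp [dTail, mulHead]

lemma dTail_shuf_cons (g k : K) (gs ks : List K) (f : List K → M) :
    dTail gs (k :: ks) (fun a b => shuf (g :: a) b f) =
      dTail gs (k :: ks) (fun a b => shuf a b (fun l => f (g :: l))) +
        ((-1 : ℤ) ^ gs.length) • dTail gs ks
          (fun a b => shuf (g :: a) b (fun l => f (MulAut.conj (g :: gs).prod k :: l))) := by
  rw [← dTail_tail k gs ks, ← dTail_zsmul, ← dTail_add]
  apply dTail_congr
  intro l a hl ha
  simp only [List.map_cons, shuf, List.tail_cons, ← hl, List.prod_cons, ← ha]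
  simp [mul_assoc]

lemma dBar_shuf_cons (g k : K) (gs ks : List K) (f : List K → M) :
    dBar (fun l => shuf (g :: gs) (k :: l) f) ks =
      dBar (fun l => shuf gs (k :: l) (fun l => f (g :: l))) ks +
        ((-1 : ℤ) ^ (gs.length + 1)) •
          dBar (fun l => shuf (g :: gs) l (fun l => f (MulAut.conj (g :: gs).prod k :: l))) ks := by
  simp only [dBar, ← dTail_zsmul, ← dTail_add, shuf]

/-- The shuffle sum is a chain map, with first faces omitted. -/
lemma shuf_dBar (gs ks : List K) (f : List K → M) :
    shuf gs ks (dBar f) = dTail gs ks (fun a b => shuf a b f) +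
      ((-1 : ℤ) ^ gs.length) • dBar (fun l => shuf gs l f) ks := by
  induction gs, ks, f using shuf.induct with
  | case1 ks f => simp [shuf, dTail]
  | case2 g gs f =>
    rw [shuf_nil_right, dTail_congr (Ψ := fun a _ => f a), dTail_const]
    · simp [dBar, dTail]
    · intro l a _ _
      simp [shuf_nil_right]
  | case3 g gs k ks f ih₁ ih₂ =>
    rw [shuf]
    simp only [dBar_cons f, shuf_sub, shuf_neg, ih₁, ih₂]
    rw [dBar_cons _ k ks, dBar_cons _ k ks, dBar_shuf_cons]
    cases gs with
    | nil =>
      cases ks with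
      | nil =>
        simp [dTail, shuf, mulHead, dBar]
        abel
      | cons k' ks =>
        simp [dTail, shuf, mulHead]
        module
    | cons g' gs =>
      have hG : dTail (g :: g' :: gs) (k :: ks) (fun a b => shuf a b f) =
          -shuf (g * g' :: gs) (k :: ks) f -
            dTail (g' :: gs) (k :: ks) (fun a b => shuf (g :: a) b f) := by rw [dTail]
      rw [hG, dTail_shuf_cons]
      cases ks with
      | nil =>
        simp [dTail, shuf, mulHead, shuf_nil_right]
        module
      | cons k' ks =>
        simp [dTail, shuf, mulHead]
        module

end Lists

section Perms

variable {K M}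

/-- The shuffle condition on permutations of `Fin n`, with the number `p` of letters in the first
block as a separate parameter. -/
def IsShuf (n p : ℕ) (σ : Equiv.Perm (Fin n)) : Prop :=
  ∀ i j : Fin n, i < j → (((j : ℕ) < p) ∨ (p ≤ (i : ℕ))) → σ i < σ j

/-- The permutation of `Fin (n + 1)` sending `a` to `0` that restricts to `τ` on the complements. -/
def extPerm {n : ℕ} (a : Fin (n + 1)) (τ : Equiv.Perm (Fin n)) : Equiv.Perm (Fin (n + 1)) :=
  Equiv.Perm.decomposeFin.symm (0, τ) * a.cycleRange

lemma extPerm_self {n : ℕ} (a : Fin (n + 1)) (τ : Equiv.Perm (Fin n)) : extPerm a τ a = 0 := by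
  simp [extPerm]

lemma extPerm_succAbove {n : ℕ} (a : Fin (n + 1)) (τ : Equiv.Perm (Fin n)) (i : Fin n) :
    extPerm a τ (a.succAbove i) = (τ i).succ := by
  simp [extPerm, Fin.cycleRange_succAbove]

lemma extPerm_symm_zero {n : ℕ} (a : Fin (n + 1)) (τ : Equiv.Perm (Fin n)) :
    (extPerm a τ).symm 0 = a := by
  rw [Equiv.symm_apply_eq, extPerm_self]

lemma extPerm_symm_succ {n : ℕ} (a : Fin (n + 1)) (τ : Equiv.Perm (Fin n)) (j : Fin n) :
    (extPerm a τ).symm j.succ = a.succAbove (τ.symm j) := by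
  rw [Equiv.symm_apply_eq, extPerm_succAbove, Equiv.apply_symm_apply]

lemma sign_extPerm {n : ℕ} (a : Fin (n + 1)) (τ : Equiv.Perm (Fin n)) :
    Equiv.Perm.sign (extPerm a τ) = (-1) ^ (a : ℕ) * Equiv.Perm.sign τ := by
  simp [extPerm, Equiv.Perm.decomposeFin.symm_sign, mul_comm]

lemma extPerm_bijective {n : ℕ} :
    Function.Bijective fun x : Fin (n + 1) × Equiv.Perm (Fin n) => extPerm x.1 x.2 := by
  rw [Fintype.bijective_iff_injective_and_card]
  constructor
  · rintro ⟨a, τ⟩ ⟨b, υ⟩ h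
    have hab : a = b := by
      rw [← extPerm_symm_zero a τ, ← extPerm_symm_zero b υ]
      exact congrArg (fun σ => σ.symm 0) h
    subst hab
    simpa [extPerm] using h
  · simp [Fintype.card_perm, Nat.factorial_succ]

lemma isShuf_extPerm_zero {n p : ℕ} (τ : Equiv.Perm (Fin n)) :
    IsShuf (n + 1) (p + 1) (extPerm 0 τ) ↔ IsShuf n p τ := by
  have h := extPerm_succAbove 0 τ
  simp only [Fin.succAbove_zero] at h
  constructor
  · intro H i j hij hp
    have := H i.succ j.succ (by simpa using hij) (by simpa using hp)
    simpa [h] using this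
  · intro H i j hij hp
    obtain ⟨j, rfl⟩ := Fin.exists_succ_eq.2 (Fin.ne_zero_of_lt hij)
    cases i using Fin.cases with
    | zero => simp [h, extPerm_self]
    | succ i => simpa [h] using H i j (by simpa using hij) (by simpa using hp)

lemma isShuf_extPerm_block {n p : ℕ} (hp : p < n + 1) (τ : Equiv.Perm (Fin n)) :
    IsShuf (n + 1) p (extPerm ⟨p, hp⟩ τ) ↔ IsShuf n p τ := by
  have h := extPerm_succAbove ⟨p, hp⟩ τ
  have hv : ∀ i : Fin n, ((Fin.succAbove ⟨p, hp⟩ i : Fin (n + 1)) : ℕ) =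
      if (i : ℕ) < p then (i : ℕ) else i + 1 := by
    intro i
    simp only [Fin.succAbove, Fin.lt_def, Fin.val_castSucc]
    split_ifs <;> simp
  constructor
  · intro H i j hij hc
    have := H (Fin.succAbove ⟨p, hp⟩ i) (Fin.succAbove ⟨p, hp⟩ j)
      (by simpa using hij) (by rw [hv, hv]; split_ifs <;> omega)
    simpa [h] using this
  · intro H i j hij hc
    by_cases hj : j = ⟨p, hp⟩
    · subst hj
      simp [Fin.lt_def] at hij hc
      omega
    obtain ⟨j, rfl⟩ := Fin.exists_succAbove_eq hj
    rw [h]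
    by_cases hi : i = ⟨p, hp⟩
    · subst hi
      simp [extPerm_self]
    obtain ⟨i, rfl⟩ := Fin.exists_succAbove_eq hi
    rw [h, Fin.succ_lt_succ_iff]
    refine H i j (by simpa using hij) ?_
    rw [hv, hv] at hc
    split_ifs at hc <;> omega

lemma eq_of_isShuf_extPerm {n p : ℕ} {a : Fin (n + 1)} {τ : Equiv.Perm (Fin n)}
    (H : IsShuf (n + 1) p (extPerm a τ)) : (a : ℕ) = 0 ∨ (a : ℕ) = p := by
  by_contra hc
  push Not at hc
  have := H ⟨a - 1, by omega⟩ a (Fin.lt_def.2 (by simp only; omega))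
    (by simp only; omega)
  simp [extPerm_self] at this

lemma IsShuf.le_add {n p : ℕ} {σ : Equiv.Perm (Fin n)} (H : IsShuf n p σ) (i : Fin n) :
    (i : ℕ) ≤ p + σ i := by
  obtain ⟨i, hi⟩ := i
  induction i with
  | zero => simp
  | succ i ih =>
    by_cases hp : p ≤ i
    · have h1 := ih (by omega)
      have h2 := H ⟨i, by omega⟩ ⟨i + 1, hi⟩ (by simp [Fin.lt_def]) (Or.inr hp)
      simp only [Fin.lt_def] at h1 h2 ⊢
      omega
    · simp only
      omega

lemma isShuf_iff_eq_one {n p : ℕ} (h : p = 0 ∨ n ≤ p) (σ : Equiv.Perm (Fin n)) :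
    IsShuf n p σ ↔ σ = 1 := by
  constructor
  · intro H
    have hm : StrictMono σ := fun i j hij => H i j hij (by omega)
    ext i
    have : (hm.orderIsoOfSurjective σ σ.surjective) = OrderIso.refl _ := Subsingleton.elim _ _
    simpa using congrArg (fun e : Fin n ≃o Fin n => ((e i : Fin n) : ℕ)) this
  · rintro rfl i j hij _
    exact hij

/-- The list of entries of the shuffle of `gs` and `ks` along `σ`. -/
def shufList {n : ℕ} (σ : Equiv.Perm (Fin n)) (gs ks : List K) : List K :=
  List.ofFn fun j =>
    if (σ.symm j : ℕ) < gs.length then gs.getD (σ.symm j) 1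
    else MulAut.conj (gs.drop (gs.length + j - σ.symm j)).prod
      (ks.getD ((σ.symm j : ℕ) - gs.length) 1)

lemma shufList_extPerm_zero {n : ℕ} {τ : Equiv.Perm (Fin n)} {gs ks : List K} (g : K)
    (H : IsShuf n gs.length τ) :
    shufList (extPerm 0 τ) (g :: gs) ks = g :: shufList τ gs ks := by
  simp only [shufList, List.ofFn_succ, extPerm_symm_zero, extPerm_symm_succ]
  congr 2
  funext j
  have hle := H.le_add (τ.symm j)
  rw [Equiv.apply_symm_apply] at hle
  have hd : (gs.length + 1 + (j + 1) - ((τ.symm j : ℕ) + 1)) =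
      (gs.length + j - τ.symm j) + 1 := by omega
  simp [hd]

lemma shufList_extPerm_block {n : ℕ} {τ : Equiv.Perm (Fin n)} {gs ks : List K} (k : K)
    (hp : gs.length < n + 1) :
    shufList (extPerm ⟨gs.length, hp⟩ τ) gs (k :: ks) =
      MulAut.conj gs.prod k :: shufList τ gs ks := by
  simp only [shufList, List.ofFn_succ, extPerm_symm_zero, extPerm_symm_succ]
  congr 2
  · simp
  · funext j
    by_cases h : (τ.symm j : ℕ) < gs.length
    · have hs : Fin.succAbove ⟨gs.length, hp⟩ (τ.symm j) = (τ.symm j).castSucc :=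
        Fin.succAbove_of_castSucc_lt _ _ (by simpa [Fin.lt_def] using h)
      simp [hs, h]
    · have hs : Fin.succAbove ⟨gs.length, hp⟩ (τ.symm j) = (τ.symm j).succ :=
        Fin.succAbove_of_le_castSucc _ _ (by simpa [Fin.le_def] using h)
      have hd : gs.length + (j + 1) - ((τ.symm j : ℕ) + 1) = gs.length + j - τ.symm j := by omega
      have hk : (τ.symm j : ℕ) + 1 - gs.length = (τ.symm j - gs.length) + 1 := by omega
      have h' : ¬ (τ.symm j : ℕ) + 1 < gs.length := by omega
      simp only [hs, Fin.val_succ, h, h', if_false, hd, hk, List.getD_cons_succ]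

lemma shufList_one_nil_left {n : ℕ} (ks : List K) (hn : ks.length = n) :
    shufList (1 : Equiv.Perm (Fin n)) [] ks = ks := by
  refine List.ext_getElem (by simp [shufList, hn]) fun i h h' => ?_
  simp [shufList, Equiv.Perm.one_def, h']

lemma shufList_one_nil_right {n : ℕ} (gs : List K) (hn : gs.length = n) :
    shufList (1 : Equiv.Perm (Fin n)) gs [] = gs := by
  refine List.ext_getElem (by simp [shufList, hn]) fun i h h' => ?_
  simp [shufList, Equiv.Perm.one_def, h']

open scoped Classical in
/-- The sum over shuffle permutations satisfies the recursion defining `shuf`. -/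
lemma sum_isShuf (gs ks : List K) (f : List K → M) (n : ℕ) (hn : gs.length + ks.length = n) :
    ∑ σ : Equiv.Perm (Fin n), (if IsShuf n gs.length σ then
      ((Equiv.Perm.sign σ : ℤˣ) : ℤ) • f (shufList σ gs ks) else 0) = shuf gs ks f := by
  induction gs, ks, f using shuf.induct generalizing n with
  | case1 ks f =>
    simp only [isShuf_iff_eq_one (Or.inl rfl), List.length_nil, Finset.sum_ite_eq',
      Finset.mem_univ, if_true, shuf, shufList_one_nil_left ks (by simpa using hn)]
    simp
  | case2 g gs f =>
    simp only [isShuf_iff_eq_one (n := n) (p := (g :: gs).length) (Or.inr (by simp_all)),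
      Finset.sum_ite_eq', Finset.mem_univ, if_true, shuf,
      shufList_one_nil_right (g :: gs) (by simpa using hn)]
    simp
  | case3 g gs k ks f ih₁ ih₂ =>
    obtain ⟨m, rfl⟩ : ∃ m, n = m + 1 := ⟨gs.length + ks.length + 1, by simp at hn; omega⟩
    simp only [List.length_cons] at hn
    have hp : gs.length + 1 < m + 1 := by omega
    rw [← extPerm_bijective.sum_comp, Fintype.sum_prod_type,
      Finset.sum_eq_add (0 : Fin (m + 1)) ⟨gs.length + 1, hp⟩ (by simp [Fin.ext_iff])]
    · rw [shuf, ← ih₁ m (by simp; omega), ← ih₂ m (by simp; omega), Finset.smul_sum]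
      congr 1
      · refine Finset.sum_congr rfl fun τ _ => ?_
        simp only [List.length_cons, isShuf_extPerm_zero]
        refine if_ctx_congr Iff.rfl (fun H => ?_) (fun _ => rfl)
        rw [shufList_extPerm_zero g H, sign_extPerm]
        simp
      · refine Finset.sum_congr rfl fun τ _ => ?_
        simp only [List.length_cons, isShuf_extPerm_block, smul_ite, smul_zero]
        refine if_ctx_congr Iff.rfl (fun H => ?_) (fun _ => rfl)
        have := shufList_extPerm_block (τ := τ) (gs := g :: gs) (ks := ks) k (by simpa using hp)
        simp only [List.length_cons] at this
        rw [this, sign_extPerm, smul_smul]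
        simp
    · rintro a - ⟨h0, h1⟩
      refine Finset.sum_eq_zero fun τ _ => if_neg fun H => ?_
      rcases eq_of_isShuf_extPerm H with h | h
      · exact h0 (Fin.ext h)
      · exact h1 (Fin.ext h)
    · simp
    · simp

/-- A bar cochain as a function on lists. -/
def onLists {n : ℕ} (F : SC K M n) (l : List K) : M :=
  F (fun j => l.getD j 1, fun i => i.elim0)

/-- The components of the dual shuffle homomorphism as recursive shuffle sums. -/
lemma tauDualA_eq_shuf (n : ℕ) (F : SC K M n) (p : Fin n)
    (x : (Fin (p : ℕ) → K) × (Fin (n - (p : ℕ)) → K)) :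
    tauDualA K M n F p x = shuf (List.ofFn x.1) (List.ofFn x.2) (onLists F) := by
  classical
  have key : ∀ (σ : Equiv.Perm (Fin (p + (n - p)))) (j : Fin (p + (n - p))),
      (shufList σ (List.ofFn x.1) (List.ofFn x.2)).getD j 1 =
        shuffleTuple K p (n - p) σ x.1 x.2 j := by
    intro σ j
    have hs := (σ.symm j).isLt
    rw [List.getD_eq_getElem _ _ (by simp only [shufList, List.length_ofFn, j.isLt])]
    simp only [shufList, shuffleTuple, prefixProd, List.length_ofFn, MulAut.conj_apply,
      List.getElem_ofFn]
    split_ifs with h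
    · rw [List.getD_eq_getElem _ _ (by simpa using h), List.getElem_ofFn]
    · rw [List.getD_eq_getElem _ _ (by simp; omega), List.getElem_ofFn]
  rw [← sum_isShuf _ _ _ ((p : ℕ) + (n - p)) (by simp)]
  unfold tauDualA tauBar onLists
  rw [← Finsupp.sum_finsetSum_index (by simp) (by simp [add_smul]), Finset.sum_filter]
  refine Finset.sum_congr (by ext; simp) fun σ _ => ?_
  simp only [List.length_ofFn]
  refine if_ctx_congr Iff.rfl (fun H => ?_) (fun _ => rfl)
  rw [Finsupp.smul_single, Finsupp.sum_single_index (by simp)]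
  congr 1
  · simp
  congr 2
  funext j
  refine Eq.trans ?_ (key σ (Fin.cast (by omega) j)).symm
  simp

end Perms

section ChainMap

variable {K M}

lemma ofFn_mergeD_zero {p : ℕ} (x : Fin (p + 2) → K) :
    List.ofFn (mergeD 0 x) = x 0 * x 1 :: List.ofFn (fun j : Fin p => x j.succ.succ) := by
  rw [List.ofFn_succ]
  simp [mergeD]

lemma ofFn_mergeD_succ {p : ℕ} (i : ℕ) (x : Fin (p + 2) → K) :
    List.ofFn (mergeD (i + 1) x) =
      x 0 :: List.ofFn (mergeD i (fun j : Fin (p + 1) => x j.succ)) := by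
  rw [List.ofFn_succ]
  simp [mergeD]
  rfl

lemma dTail_ofFn {p : ℕ} (x : Fin (p + 1) → K) (ks : List K) (Φ : List K → List K → M) :
    dTail (List.ofFn x) ks Φ =
      ∑ i ∈ Finset.range p, ((-1 : ℤ) ^ (i + 1)) • Φ (List.ofFn (mergeD i x)) ks +
      ((-1 : ℤ) ^ (p + 1)) • Φ (List.ofFn fun j => x j.castSucc)
        (ks.map (MulAut.conj (x (Fin.last p)))) := by
  induction p generalizing Φ with
  | zero => simp [dTail]
  | succ p ih =>
    have e : List.ofFn x = x 0 :: x 1 :: List.ofFn (fun j : Fin p => x j.succ.succ) := by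
      rw [List.ofFn_succ, List.ofFn_succ]
      rfl
    have e' : x 1 :: List.ofFn (fun j : Fin p => x j.succ.succ) =
        List.ofFn (fun j => x j.succ) := by
      rw [List.ofFn_succ]
      rfl
    rw [e, dTail, e', ih, Finset.sum_range_succ', ofFn_mergeD_zero,
      List.ofFn_succ (f := fun j : Fin (p + 1) => x j.castSucc)]
    simp only [ofFn_mergeD_succ, pow_succ _ (_ + 1), mul_neg_one, neg_smul,
      Finset.sum_neg_distrib, Fin.castSucc_zero, Fin.succ_castSucc, Fin.succ_last]
    simp
    abel

lemma ofFn_cast {α : Type} {m n : ℕ} (h : m = n) (f : Fin n → α) :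
    List.ofFn (fun i : Fin m => f (Fin.cast h i)) = List.ofFn f := by
  subst h
  rfl

/-- The differential `δ_G` of a cochain given by a function on lists. -/
lemma dGfun_ofFn {p q : ℕ} (F : Cpq K K M p q) (Φ : List K → List K → M)
    (h : ∀ x, F x = Φ (List.ofFn x.1) (List.ofFn x.2))
    (x : (Fin (p + 1) → K) × (Fin q → K)) :
    dGfun K K MulAut.conj M F x = Φ (List.ofFn x.1).tail (List.ofFn x.2) +
      dTail (List.ofFn x.1) (List.ofFn x.2) Φ := by
  rw [dTail_ofFn, dGfun]
  simp only [h, List.map_ofFn, List.ofFn_succ (f := x.1), List.tail_cons, add_assoc]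
  rfl

/-- The differential `δ_K` of a cochain given by a function on lists. -/
lemma dKfun_ofFn {p q : ℕ} (F : Cpq K K M p q) (Φ : List K → List K → M)
    (h : ∀ x, F x = Φ (List.ofFn x.1) (List.ofFn x.2))
    (x : (Fin p → K) × (Fin (q + 1) → K)) :
    dKfun K K M F x = Φ (List.ofFn x.1) (List.ofFn x.2).tail +
      dBar (Φ (List.ofFn x.1)) (List.ofFn x.2) := by
  rw [dBar, dTail_ofFn, dKfun]
  simp only [h, List.ofFn_succ (f := x.2), List.tail_cons, add_assoc]

lemma onLists_ofFn {n : ℕ} (F : SC K M n) (x : (Fin n → K) × (Fin 0 → K)) :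
    onLists F (List.ofFn x.1) = F x := by
  unfold onLists
  congr 1
  ext i
  · simp
  · exact i.elim0

lemma onLists_dGhom {n : ℕ} (F : SC K M n) (l : List K) (hl : l.length = n + 1) :
    onLists (dGhom K K MulAut.conj M n 0 F) l = onLists F l.tail + dBar (onLists F) l := by
  obtain ⟨y, rfl⟩ : ∃ y : Fin (n + 1) → K, l = List.ofFn y :=
    ⟨fun i => l[i],
      List.ext_getElem (by simp [hl]) (fun _ _ _ => by rw [List.getElem_ofFn]; rfl)⟩
  refine (onLists_ofFn (dGhom K K MulAut.conj M n 0 F) (y, fun i => i.elim0)).trans ?_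
  refine (dGfun_ofFn F (fun a _ => onLists F a) (fun x => (onLists_ofFn F x).symm) _).trans ?_
  rw [dTail_const]

/-- The shuffle sum of a bar coboundary, for a nonempty second list. -/
lemma shuf_coboundary (gs : List K) (k : K) (ks : List K) (f : List K → M) :
    shuf gs (k :: ks) (fun l => f l.tail + dBar f l) =
      (if gs = [] then 0 else
        shuf gs.tail (k :: ks) f + dTail gs (k :: ks) (fun a b => shuf a b f)) +
      ((-1 : ℤ) ^ gs.length) • (shuf gs ks f + dBar (fun l => shuf gs l f) (k :: ks)) := by
  rw [shuf_add, shuf_dBar]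
  cases gs with
  | nil => simp [shuf, dTail]
  | cons g gs =>
    rw [shuf]
    simp only [List.tail_cons, List.length_cons, reduceCtorEq, if_false]
    module

/-- The restricted dual shuffle homomorphism commutes with the differentials. -/
lemma tauDualA_dGhom (n : ℕ) (F : SC K M n) :
    tauDualA K M (n + 1) (dGhom K K MulAut.conj M n 0 F) =
      totdA K K MulAut.conj M n (tauDualA K M n F) := by
  funext p x
  rw [tauDualA_eq_shuf, shuf_congr (fun l hl => onLists_dGhom F l (by simp at hl; omega))]
  have hlen : (List.ofFn x.2).length = n + 1 - p := by simp
  obtain ⟨k, ks, hks⟩ : ∃ k ks, List.ofFn x.2 = k :: ks := by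
    apply List.exists_cons_of_length_pos
    omega
  rw [hks, shuf_coboundary]
  change _ = totdAFun K K MulAut.conj M (tauDualA K M n F) p x
  rw [totdAFun, Pi.add_apply]
  congr 1
  · by_cases h1 : 1 ≤ (p : ℕ)
    · rw [dif_pos h1, if_neg (by rw [← List.length_eq_zero_iff, List.length_ofFn]; omega)]
      refine Eq.symm ((dGfun_ofFn _ (fun a b => shuf a b (onLists F))
        (tauDualA_eq_shuf n F _) _).trans ?_)
      simp only [ofFn_cast, hks]
    · rw [dif_neg h1, if_pos (by rw [← List.length_eq_zero_iff, List.length_ofFn]; omega),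
        Pi.zero_apply]
  · rw [Pi.smul_apply, List.length_ofFn]
    congr 1
    by_cases h2 : (p : ℕ) < n
    · rw [dif_pos h2]
      refine Eq.symm ((dKfun_ofFn _ (fun a b => shuf a b (onLists F))
        (tauDualA_eq_shuf n F _) _).trans ?_)
      simp only [ofFn_cast, hks, List.tail_cons]
    · rw [dif_neg h2, Pi.zero_apply]
      obtain rfl : ks = [] := by
        rw [← List.length_eq_zero_iff]
        rw [hks, List.length_cons] at hlen
        omega
      simp [dBar, dTail]

lemma tauDualA_add (n : ℕ) (F F' : SC K M n) :
    tauDualA K M n (F + F') = tauDualA K M n F + tauDualA K M n F' := by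
  funext p x
  simp only [Pi.add_apply, tauDualA_eq_shuf, ← shuf_add]
  rfl

lemma tauDualA_mem_nrmA {n : ℕ} {F : SC K M n} (hF : F ∈ nrm K K M n 0) :
    tauDualA K M n F ∈ nrmA K K M n := by
  intro p _ x hx
  rw [tauDualA_eq_shuf]
  apply shuf_eq_zero
  · intro l hl h1
    apply hF
    left
    obtain ⟨i, hi, hi1⟩ := List.getElem_of_mem h1
    refine ⟨⟨i, by simp at hl; omega⟩, ?_⟩
    simp [hi, hi1]
  · simpa [List.mem_ofFn] using hx

lemma inclBA_add (n : ℕ) (b b' : TotB K K M n) :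
    inclBA K M n (b + b') = inclBA K M n b + inclBA K M n b' := by
  funext p
  by_cases h : 1 ≤ (p : ℕ)
  · simp only [inclBA, dif_pos h, Pi.add_apply, castC_add]
  · simp only [inclBA, dif_neg h, Pi.add_apply, add_zero]

lemma inclBA_mem_nrmA {n : ℕ} {b : TotB K K M n} :
    inclBA K M n b ∈ nrmA K K M n ↔ b ∈ nrmB K K M n := by
  constructor
  · intro h p _
    exact h ⟨p + 1, by omega⟩ trivial
  · rintro h ⟨p, hp⟩ -
    cases p with
    | zero => exact zero_mem (nrm K K M 0 (n - 0))
    | succ p => exact h ⟨p, by omega⟩ trivial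

lemma inclBA_injective (n : ℕ) : Function.Injective (inclBA K M n) := by
  intro b b' h
  funext p
  exact congrFun h ⟨p + 1, by omega⟩

/-- The inclusion of `Tot(B)` into `Tot(A)` commutes with the differentials. -/
lemma inclBA_totdB (n : ℕ) (b : TotB K K M n) :
    inclBA K M (n + 1) (totdB K K MulAut.conj M n b) =
      totdA K K MulAut.conj M n (inclBA K M n b) := by
  funext ⟨p, hp⟩
  change _ = totdAFun K K MulAut.conj M (inclBA K M n b) ⟨p, hp⟩
  cases p with
  | zero =>
    by_cases h : 0 < n <;> simp [inclBA, totdAFun, h]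
    rfl
  | succ p =>
    change totdBFun K K MulAut.conj M b ⟨p, by omega⟩ = _
    unfold totdBFun totdAFun
    congr 1
    · cases p with
      | zero =>
        simp [inclBA]
        rfl
      | succ p => rfl
    · congr 1
      by_cases h2 : p + 1 < n
      · rw [dif_pos (show p < n - 1 by omega), dif_pos h2]
        rfl
      · rw [dif_neg (show ¬ p < n - 1 by omega), dif_neg h2]

end ChainMap

section Splitting

variable {K M}

/-- The homomorphism `(F, y) ↦ τ₁∨ F + y` on cochains. -/
noncomputable def splitHom (n : ℕ) : SC K M n × TotB K K M n →+ TotA K K M n :=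
  AddMonoidHom.mk' (fun x => tauDualA K M n x.1 + inclBA K M n x.2) fun x y => by
    simp only [Prod.fst_add, Prod.snd_add, tauDualA_add, inclBA_add]
    abel

lemma splitHom_apply (n : ℕ) (x : SC K M n × TotB K K M n) :
    splitHom n x = tauDualA K M n x.1 + inclBA K M n x.2 := rfl

lemma splitHom_zero {n : ℕ} (hn : 0 < n) (x : SC K M n × TotB K K M n)
    (y : (Fin 0 → K) × (Fin n → K)) :
    splitHom n x ⟨0, hn⟩ y = x.1 (y.2, fun i => i.elim0) := by
  have h : inclBA K M n x.2 ⟨0, hn⟩ = 0 := rfl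
  rw [splitHom_apply, Pi.add_apply, h, add_zero, tauDualA_eq_shuf]
  simp only [List.ofFn_zero, shuf]
  exact onLists_ofFn x.1 (y.2, fun i => i.elim0)

lemma splitHom_mem_nrmA {n : ℕ} (hn : 0 < n) (x : SC K M n × TotB K K M n) :
    splitHom n x ∈ nrmA K K M n ↔ x.1 ∈ nrm K K M n 0 ∧ x.2 ∈ nrmB K K M n := by
  constructor
  · intro h
    have h1 : x.1 ∈ nrm K K M n 0 := by
      rintro ⟨a, b⟩ hab
      have := h ⟨0, hn⟩ trivial (fun i => i.elim0, a)
        (Or.inr (hab.resolve_right fun ⟨i, _⟩ => i.elim0))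
      rw [splitHom_zero hn x] at this
      rwa [Subsingleton.elim b fun i => i.elim0]
    refine ⟨h1, inclBA_mem_nrmA.1 ?_⟩
    simpa [splitHom_apply] using sub_mem h (tauDualA_mem_nrmA h1)
  · rintro ⟨h1, h2⟩
    exact add_mem (tauDualA_mem_nrmA h1) (inclBA_mem_nrmA.2 h2)

lemma splitHom_injective {n : ℕ} (hn : 0 < n) :
    Function.Injective (splitHom (K := K) (M := M) n) := by
  rw [injective_iff_map_eq_zero]
  rintro ⟨F, b⟩ h
  have h1 : F = 0 := by
    funext ⟨x, y⟩
    have := splitHom_zero hn (F, b) (fun i => i.elim0, x)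
    rw [h] at this
    rw [Subsingleton.elim y fun i => i.elim0]
    exact this.symm
  subst h1
  have h0 : inclBA K M n b = splitHom n (0, b) := by
    have : tauDualA K M n 0 = 0 := by simpa using tauDualA_add n (0 : SC K M n) 0
    simp [splitHom_apply, this]
  have h2 : inclBA K M n 0 = 0 := by simpa using inclBA_add n (0 : TotB K K M n) 0
  rw [h, ← h2] at h0
  exact Prod.ext rfl (inclBA_injective n h0)

lemma splitHom_surjective (n : ℕ) : Function.Surjective (splitHom (K := K) (M := M) n) := by
  intro a
  rcases Nat.eq_zero_or_pos n with rfl | hn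
  · exact ⟨0, Subsingleton.elim _ _⟩
  let F : SC K M n := fun x => a ⟨0, hn⟩ (fun i => i.elim0, x.1)
  let b : TotB K K M n := fun p => (a - tauDualA K M n F) ⟨p + 1, by omega⟩
  refine ⟨(F, b), ?_⟩
  funext ⟨p, hp⟩
  cases p with
  | zero =>
    funext ⟨x, y⟩
    refine (splitHom_zero hn (F, b) (x, y)).trans ?_
    rw [Subsingleton.elim x fun i => i.elim0]
  | succ p =>
    have : inclBA K M n b ⟨p + 1, hp⟩ = (a - tauDualA K M n F) ⟨p + 1, hp⟩ := rfl
    rw [splitHom_apply, Pi.add_apply, this, Pi.sub_apply, add_sub_cancel]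

lemma totdA_splitHom (n : ℕ) (x : SC K M n × TotB K K M n) :
    totdA K K MulAut.conj M n (splitHom n x) =
      splitHom (n + 1) (dGhom K K MulAut.conj M n 0 x.1, totdB K K MulAut.conj M n x.2) := by
  rw [splitHom_apply, splitHom_apply, map_add, tauDualA_dGhom, inclBA_totdB]

lemma splitHom_mem_ZA {n : ℕ} (hn : 0 < n) (x : SC K M n × TotB K K M n) :
    splitHom n x ∈ ZA K K MulAut.conj M n ↔
      x.1 ∈ ZS K M n ∧ x.2 ∈ ZB K K MulAut.conj M n := by
  simp only [ZA, ZS, ZB, AddSubgroup.mem_inf, AddMonoidHom.mem_ker, splitHom_mem_nrmA hn,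
    totdA_splitHom, map_eq_zero_iff _ (splitHom_injective (Nat.succ_pos n)), Prod.mk_eq_zero]
  tauto

lemma splitHom_mem_BA {n : ℕ} (hn : 0 < n) (x : SC K M n × TotB K K M n) :
    splitHom n x ∈ BA K K MulAut.conj M n ↔
      x.1 ∈ BS K M n ∧ x.2 ∈ BB K K MulAut.conj M n := by
  obtain ⟨m, rfl⟩ : ∃ m, n = m + 1 := ⟨n - 1, by omega⟩
  constructor
  · rintro ⟨a, ha, hax⟩
    obtain ⟨y, hy, rfl⟩ : ∃ y : SC K M m × TotB K K M m,
        (y.1 ∈ nrm K K M m 0 ∧ y.2 ∈ nrmB K K M m) ∧ splitHom m y = a := by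
      rcases Nat.eq_zero_or_pos m with rfl | hm
      · exact ⟨0, ⟨zero_mem _, zero_mem _⟩, Subsingleton.elim _ _⟩
      · obtain ⟨y, rfl⟩ := splitHom_surjective m a
        exact ⟨y, (splitHom_mem_nrmA hm y).1 ha, rfl⟩
    rw [totdA_splitHom] at hax
    have := splitHom_injective hn hax
    subst this
    exact ⟨⟨_, hy.1, rfl⟩, ⟨_, hy.2, rfl⟩⟩
  · obtain ⟨F, b⟩ := x
    rintro ⟨⟨F', hF', rfl⟩, ⟨b', hb', rfl⟩⟩
    exact ⟨splitHom m (F', b'), add_mem (tauDualA_mem_nrmA hF') (inclBA_mem_nrmA.2 hb'),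
      totdA_splitHom m (F', b')⟩

/-- An isomorphism onto `A` from a direct sum that matches subgroups `Z` and `B` induces an
isomorphism of the quotients. -/
lemma exists_quotient_addEquiv {X Y A : Type} [AddCommGroup X] [AddCommGroup Y] [AddCommGroup A]
    (φ : X × Y →+ A) (hφ : Function.Surjective φ) {ZX BX : AddSubgroup X} {ZY BY : AddSubgroup Y}
    {ZA' BA' : AddSubgroup A} (hZ : ∀ x, φ x ∈ ZA' ↔ x.1 ∈ ZX ∧ x.2 ∈ ZY)
    (hB : ∀ x, φ x ∈ BA' ↔ x.1 ∈ BX ∧ x.2 ∈ BY) :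
    ∃ e : ((ZX ⧸ BX.addSubgroupOf ZX) × (ZY ⧸ BY.addSubgroupOf ZY)) ≃+
        (ZA' ⧸ BA'.addSubgroupOf ZA'),
      ∀ (x : X) (hx : x ∈ ZX) (y : Y) (hy : y ∈ ZY), ∃ hm : φ (x, y) ∈ ZA',
        e (QuotientAddGroup.mk ⟨x, hx⟩, QuotientAddGroup.mk ⟨y, hy⟩) =
          QuotientAddGroup.mk ⟨φ (x, y), hm⟩ := by
  let ψX : ZX →+ ZA' := ((φ.comp (AddMonoidHom.inl X Y)).comp ZX.subtype).codRestrict ZA'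
    fun x => (hZ _).2 ⟨x.2, zero_mem _⟩
  let ψY : ZY →+ ZA' := ((φ.comp (AddMonoidHom.inr X Y)).comp ZY.subtype).codRestrict ZA'
    fun y => (hZ _).2 ⟨zero_mem _, y.2⟩
  let f := (QuotientAddGroup.map (BX.addSubgroupOf ZX) (BA'.addSubgroupOf ZA') ψX
      fun x hx => (hB _).2 ⟨hx, zero_mem _⟩).coprod
    (QuotientAddGroup.map (BY.addSubgroupOf ZY) (BA'.addSubgroupOf ZA') ψY
      fun y hy => (hB _).2 ⟨zero_mem _, hy⟩)
  have hf : ∀ (x : X) (hx : x ∈ ZX) (y : Y) (hy : y ∈ ZY),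
      f (QuotientAddGroup.mk ⟨x, hx⟩, QuotientAddGroup.mk ⟨y, hy⟩) =
        QuotientAddGroup.mk ⟨φ (x, y), (hZ (x, y)).2 ⟨hx, hy⟩⟩ := by
    intro x hx y hy
    refine (QuotientAddGroup.mk_add _ (ψX ⟨x, hx⟩) (ψY ⟨y, hy⟩)).symm.trans
      (congrArg _ (Subtype.ext ?_))
    change φ (x, 0) + φ (0, y) = φ (x, y)
    rw [← map_add]
    simp
  have hbij : Function.Bijective f := by
    constructor
    · rw [injective_iff_map_eq_zero]
      rintro ⟨a, b⟩
      induction a using QuotientAddGroup.induction_on with | _ x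
      induction b using QuotientAddGroup.induction_on with | _ y
      intro h
      rw [hf x x.2 y y.2, QuotientAddGroup.eq_zero_iff] at h
      obtain ⟨h1, h2⟩ := (hB _).1 h
      exact Prod.ext ((QuotientAddGroup.eq_zero_iff x).2 h1) ((QuotientAddGroup.eq_zero_iff y).2 h2)
    · intro c
      induction c using QuotientAddGroup.induction_on with | _ z
      obtain ⟨z, hz⟩ := z
      obtain ⟨⟨x, y⟩, rfl⟩ := hφ z
      obtain ⟨hx, hy⟩ := (hZ _).1 hz
      exact ⟨_, hf x hx y hy⟩
  exact ⟨AddEquiv.ofBijective f hbij, fun x hx y hy => ⟨(hZ (x, y)).2 ⟨hx, hy⟩, hf x hx y hy⟩⟩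

end Splitting

/-- For `K` acting on itself by conjugation, the map
`H^p(K,ℤ) ⊕ H^p(Tot^*(B^{*,*}(K ⋊ K, ℤ))) → H^p(Tot^*(A^{*,*}(K ⋊ K, ℤ)))`,
`(x, y) ↦ τ₁* x + y`, is an isomorphism for all `p > 0`. -/
theorem stmt_10 : ∀ n : ℕ, 0 < n →
    ∃ e : (HS K ℤ n × HB K K MulAut.conj ℤ n) ≃+ HA K K MulAut.conj ℤ n,
      ∀ (F : SC K ℤ n) (hF : F ∈ ZS K ℤ n) (y : TotB K K ℤ n)
        (hy : y ∈ ZB K K MulAut.conj ℤ n),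
        ∃ hm : tauDualA K ℤ n F + inclBA K ℤ n y ∈ ZA K K MulAut.conj ℤ n,
          e (QuotientAddGroup.mk ⟨F, hF⟩, QuotientAddGroup.mk ⟨y, hy⟩) =
            QuotientAddGroup.mk ⟨tauDualA K ℤ n F + inclBA K ℤ n y, hm⟩ := by
  intro n hn
  obtain ⟨e, he⟩ := exists_quotient_addEquiv (splitHom (K := K) (M := ℤ) n)
    (splitHom_surjective n) (splitHom_mem_ZA hn) (splitHom_mem_BA hn)
  exact ⟨e, he⟩

end Stmt10
end

section
/- For a group K acting on itself by conjugation, the map H^p(K,ℤ) ⊕ H^p(Tot^*(B^{*,*}(K ⋊ K,ℤ))) ⊕ H^p(K,ℤ) → H^p(K ⋊ K, ℤ), (x,y,z) ↦ τ₁*x + y + π₂*z, is an isomorphism for all p > 0, where π₂: K ⋊ K → K is projection to the second factor. -/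
set_option linter.unusedSectionVars false

namespace Stmt11

/-- Merge the entries at positions `i` and `i+1` of a tuple. -/
def mergeD {α : Type} [Mul α] {n : ℕ} (i : ℕ) (h : Fin (n + 1) → α) : Fin n → α :=
  fun j =>
    if (j : ℕ) < i then h j.castSucc
    else if (j : ℕ) = i then h j.castSucc * h j.succ
    else h j.succ

variable (G K : Type) [Group G] [Group K] (ρ : G →* MulAut K)
variable (M : Type) [AddCommGroup M]

/-- The `(p,q)` group of the double bar cochain complex: maps `G^p × K^q → M`. -/
abbrev Cpq (p q : ℕ) : Type := ((Fin p → G) × (Fin q → K)) → M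

/-- The differential `δ_G : C^{p,q} → C^{p+1,q}`. -/
def dGfun {p q : ℕ} (F : Cpq G K M p q) : Cpq G K M (p + 1) q := fun x =>
  F (fun j => x.1 j.succ, x.2) +
    ∑ i ∈ Finset.range p, ((-1 : ℤ) ^ (i + 1)) • F (mergeD i x.1, x.2) +
    ((-1 : ℤ) ^ (p + 1)) •
      F (fun j => x.1 j.castSucc, fun j => ρ (x.1 (Fin.last p)) (x.2 j))

/-- The differential `δ_K : C^{p,q} → C^{p,q+1}`. -/
def dKfun {p q : ℕ} (F : Cpq G K M p q) : Cpq G K M p (q + 1) := fun x =>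
  F (x.1, fun j => x.2 j.succ) +
    ∑ i ∈ Finset.range q, ((-1 : ℤ) ^ (i + 1)) • F (x.1, mergeD i x.2) +
    ((-1 : ℤ) ^ (q + 1)) • F (x.1, fun j => x.2 j.castSucc)

lemma dGfun_add {p q : ℕ} (F F' : Cpq G K M p q) :
    dGfun G K ρ M (F + F') = dGfun G K ρ M F + dGfun G K ρ M F' := by
  funext x
  simp only [dGfun, Pi.add_apply, smul_add, Finset.sum_add_distrib]
  abel

lemma dKfun_add {p q : ℕ} (F F' : Cpq G K M p q) :
    dKfun G K M (F + F') = dKfun G K M F + dKfun G K M F' := by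
  funext x
  simp only [dKfun, Pi.add_apply, smul_add, Finset.sum_add_distrib]
  abel

/-- `δ_G` as an additive homomorphism. -/
def dGhom (p q : ℕ) : Cpq G K M p q →+ Cpq G K M (p + 1) q :=
  AddMonoidHom.mk' (dGfun G K ρ M) (dGfun_add G K ρ M)

/-- `δ_K` as an additive homomorphism. -/
def dKhom (p q : ℕ) : Cpq G K M p q →+ Cpq G K M p (q + 1) :=
  AddMonoidHom.mk' (dKfun G K M) (dKfun_add G K M)

/-- Reindexing of bidegrees. -/
def castC {p q p' q' : ℕ} (h1 : p = p') (h2 : q = q') (F : Cpq G K M p q) :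
    Cpq G K M p' q' :=
  fun x => F (fun i => x.1 (Fin.cast h1 i), fun i => x.2 (Fin.cast h2 i))

lemma castC_add {p q p' q' : ℕ} (h1 : p = p') (h2 : q = q') (F F' : Cpq G K M p q) :
    castC G K M h1 h2 (F + F') = castC G K M h1 h2 F + castC G K M h1 h2 F' := rfl

/-- The subgroup of normalized cochains. -/
def nrm (p q : ℕ) : AddSubgroup (Cpq G K M p q) where
  carrier := {F | ∀ x, ((∃ i, x.1 i = 1) ∨ (∃ i, x.2 i = 1)) → F x = 0}
  add_mem' := by
    intro a b ha hb x hx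
    simp only [Pi.add_apply, ha x hx, hb x hx, add_zero]
  zero_mem' := by intro x _; rfl
  neg_mem' := by
    intro a ha x hx
    simp only [Pi.neg_apply, ha x hx, neg_zero]

/-- Degree `n` of the total complex of the full double complex `C^{*,*}`. -/
abbrev TotC (n : ℕ) : Type := ∀ p : Fin (n + 1), Cpq G K M (p : ℕ) (n - (p : ℕ))

/-- Degree `n` of the total complex of `A^{*,*} = C^{*,*>0}` (0-th row removed). -/
abbrev TotA (n : ℕ) : Type := ∀ p : Fin n, Cpq G K M (p : ℕ) (n - (p : ℕ))

/-- Degree `n` of the total complex of `B^{*,*} = C^{*>0,*>0}` (0-th row and column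
removed); the component indexed by `p : Fin (n-1)` has bidegree `(p+1, n-(p+1))`. -/
abbrev TotB (n : ℕ) : Type := ∀ p : Fin (n - 1), Cpq G K M ((p : ℕ) + 1) (n - ((p : ℕ) + 1))

/-- The total differential `δ_G ⊕ (-1)^p δ_K` of `C^{*,*}`, as a function. -/
def totdFun {n : ℕ} (x : TotC G K M n) : TotC G K M (n + 1) := fun p =>
  (if h1 : 1 ≤ (p : ℕ) then
    castC G K M (by omega)
      (by
        show n - ((p : ℕ) - 1) = n + 1 - (p : ℕ)
        have := p.isLt; omega)
      (dGhom G K ρ M ((p : ℕ) - 1) (n - ((p : ℕ) - 1))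
        (x ⟨(p : ℕ) - 1, by have := p.isLt; omega⟩))
  else 0) +
  ((-1 : ℤ) ^ (p : ℕ)) •
  (if h2 : (p : ℕ) ≤ n then
    castC G K M rfl (by omega)
      (dKhom G K M (p : ℕ) (n - (p : ℕ)) (x ⟨(p : ℕ), by omega⟩))
  else 0)

lemma totdFun_add {n : ℕ} (x y : TotC G K M n) :
    totdFun G K ρ M (x + y) = totdFun G K ρ M x + totdFun G K ρ M y := by
  funext p
  by_cases h1 : 1 ≤ (p : ℕ) <;> by_cases h2 : (p : ℕ) ≤ n <;>
    simp only [totdFun, Pi.add_apply, dif_pos, dif_neg, h1, h2, map_add, castC_add,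
      smul_add, add_zero, smul_zero, not_true, not_false_iff] <;> abel

/-- The total differential of `C^{*,*}` as an additive homomorphism. -/
def totd (n : ℕ) : TotC G K M n →+ TotC G K M (n + 1) :=
  AddMonoidHom.mk' (totdFun G K ρ M) (totdFun_add G K ρ M)

/-- The total differential of `A^{*,*}`, as a function. -/
def totdAFun {n : ℕ} (x : TotA G K M n) : TotA G K M (n + 1) := fun p =>
  (if h1 : 1 ≤ (p : ℕ) then
    castC G K M (by omega)
      (by
        show n - ((p : ℕ) - 1) = n + 1 - (p : ℕ)
        have := p.isLt; omega)
      (dGhom G K ρ M ((p : ℕ) - 1) (n - ((p : ℕ) - 1))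
        (x ⟨(p : ℕ) - 1, by have := p.isLt; omega⟩))
  else 0) +
  ((-1 : ℤ) ^ (p : ℕ)) •
  (if h2 : (p : ℕ) < n then
    castC G K M rfl (by omega)
      (dKhom G K M (p : ℕ) (n - (p : ℕ)) (x ⟨(p : ℕ), h2⟩))
  else 0)

lemma totdAFun_add {n : ℕ} (x y : TotA G K M n) :
    totdAFun G K ρ M (x + y) = totdAFun G K ρ M x + totdAFun G K ρ M y := by
  funext p
  by_cases h1 : 1 ≤ (p : ℕ) <;> by_cases h2 : (p : ℕ) < n <;>
    simp only [totdAFun, Pi.add_apply, dif_pos, dif_neg, h1, h2, map_add, castC_add,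
      smul_add, add_zero, smul_zero, not_true, not_false_iff] <;> abel

/-- The total differential of `A^{*,*}` as an additive homomorphism. -/
def totdA (n : ℕ) : TotA G K M n →+ TotA G K M (n + 1) :=
  AddMonoidHom.mk' (totdAFun G K ρ M) (totdAFun_add G K ρ M)

/-- The total differential of `B^{*,*}`, as a function. -/
def totdBFun {n : ℕ} (x : TotB G K M n) : TotB G K M (n + 1) := fun p =>
  (if h1 : 1 ≤ (p : ℕ) then
    castC G K M (by omega)
      (by
        show n - (((p : ℕ) - 1) + 1) = n + 1 - ((p : ℕ) + 1)
        have := p.isLt; omega)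
      (dGhom G K ρ M (((p : ℕ) - 1) + 1) (n - (((p : ℕ) - 1) + 1))
        (x ⟨(p : ℕ) - 1, by have := p.isLt; omega⟩))
  else 0) +
  ((-1 : ℤ) ^ ((p : ℕ) + 1)) •
  (if h2 : (p : ℕ) < n - 1 then
    castC G K M rfl (by omega)
      (dKhom G K M ((p : ℕ) + 1) (n - ((p : ℕ) + 1)) (x ⟨(p : ℕ), h2⟩))
  else 0)

lemma totdBFun_add {n : ℕ} (x y : TotB G K M n) :
    totdBFun G K ρ M (x + y) = totdBFun G K ρ M x + totdBFun G K ρ M y := by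
  funext p
  by_cases h1 : 1 ≤ (p : ℕ) <;> by_cases h2 : (p : ℕ) < n - 1 <;>
    simp only [totdBFun, Pi.add_apply, dif_pos, dif_neg, h1, h2, map_add, castC_add,
      smul_add, add_zero, smul_zero, not_true, not_false_iff] <;> abel

/-- The total differential of `B^{*,*}` as an additive homomorphism. -/
def totdB (n : ℕ) : TotB G K M n →+ TotB G K M (n + 1) :=
  AddMonoidHom.mk' (totdBFun G K ρ M) (totdBFun_add G K ρ M)

/-- Normalized elements of the total complex of `C^{*,*}`. -/
def nrmC (n : ℕ) : AddSubgroup (TotC G K M n) :=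
  AddSubgroup.pi Set.univ fun p => nrm G K M (p : ℕ) (n - (p : ℕ))

/-- Normalized elements of the total complex of `A^{*,*}`. -/
def nrmA (n : ℕ) : AddSubgroup (TotA G K M n) :=
  AddSubgroup.pi Set.univ fun p => nrm G K M (p : ℕ) (n - (p : ℕ))

/-- Normalized elements of the total complex of `B^{*,*}`. -/
def nrmB (n : ℕ) : AddSubgroup (TotB G K M n) :=
  AddSubgroup.pi Set.univ fun p => nrm G K M ((p : ℕ) + 1) (n - ((p : ℕ) + 1))

/-- Normalized cocycles of `Tot^n(C^{*,*})`. -/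
def ZC (n : ℕ) : AddSubgroup (TotC G K M n) := nrmC G K M n ⊓ (totd G K ρ M n).ker

/-- Normalized coboundaries of `Tot^n(C^{*,*})`. -/
def BC : ∀ n : ℕ, AddSubgroup (TotC G K M n)
  | 0 => ⊥
  | n + 1 => AddSubgroup.map (totd G K ρ M n) (nrmC G K M n)

/-- The degree `n` cohomology of `Tot^*(C^{*,*}(K ⋊ G, M))`. -/
abbrev HC (n : ℕ) :=
  ZC G K ρ M n ⧸ (BC G K ρ M n).addSubgroupOf (ZC G K ρ M n)


/-- Normalized cocycles of `Tot^n(A^{*,*})`. -/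
def ZA (n : ℕ) : AddSubgroup (TotA G K M n) := nrmA G K M n ⊓ (totdA G K ρ M n).ker

/-- Normalized coboundaries of `Tot^n(A^{*,*})`. -/
def BA : ∀ n : ℕ, AddSubgroup (TotA G K M n)
  | 0 => ⊥
  | n + 1 => AddSubgroup.map (totdA G K ρ M n) (nrmA G K M n)

/-- The degree `n` cohomology of `Tot^*(A^{*,*}(K ⋊ G, M))`. -/
abbrev HA (n : ℕ) :=
  ZA G K ρ M n ⧸ (BA G K ρ M n).addSubgroupOf (ZA G K ρ M n)


/-- Normalized cocycles of `Tot^n(B^{*,*})`. -/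
def ZB (n : ℕ) : AddSubgroup (TotB G K M n) := nrmB G K M n ⊓ (totdB G K ρ M n).ker

/-- Normalized coboundaries of `Tot^n(B^{*,*})`. -/
def BB : ∀ n : ℕ, AddSubgroup (TotB G K M n)
  | 0 => ⊥
  | n + 1 => AddSubgroup.map (totdB G K ρ M n) (nrmB G K M n)

/-- The degree `n` cohomology of `Tot^*(B^{*,*}(K ⋊ G, M))`. -/
abbrev HB (n : ℕ) :=
  ZB G K ρ M n ⧸ (BB G K ρ M n).addSubgroupOf (ZB G K ρ M n)



/-- A `(p,q)`-shuffle: a permutation of `Fin (p+q)` monotone on the first `p` and the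
last `q` letters. -/
def IsShuffle (p q : ℕ) (σ : Equiv.Perm (Fin (p + q))) : Prop :=
  ∀ i j : Fin (p + q), i < j → (((j : ℕ) < p) ∨ (p ≤ (i : ℕ))) → σ i < σ j

/-- Product `g_d ⋯ g_{p-1}` of a tail of a tuple. -/
def prefixProd {p : ℕ} (gs : Fin p → K) (d : ℕ) : K := ((List.ofFn gs).drop d).prod

/-- The tuple `λ[g₁|…|g_p|k₁|…|k_q]` associated to a `(p,q)`-shuffle `λ`:
`s_{λ(i)} = gᵢ` for `i ≤ p` and
`s_{λ(i)} = (g_{p+λ(i)-i+1}⋯g_p)·k_{i-p}·(g_{p+λ(i)-i+1}⋯g_p)⁻¹` for `i > p`. -/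
def shuffleTuple (p q : ℕ) (σ : Equiv.Perm (Fin (p + q))) (gs : Fin p → K)
    (ks : Fin q → K) : Fin (p + q) → K :=
  fun j =>
    if h : ((σ.symm j : Fin (p + q)) : ℕ) < p then gs ⟨(σ.symm j : Fin (p + q)), h⟩
    else
      prefixProd K gs (p + (j : ℕ) - ((σ.symm j : Fin (p + q)) : ℕ)) *
        ks ⟨((σ.symm j : Fin (p + q)) : ℕ) - p, by
          have := (σ.symm j).isLt; omega⟩ *
        (prefixProd K gs (p + (j : ℕ) - ((σ.symm j : Fin (p + q)) : ℕ)))⁻¹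

open scoped Classical in
/-- `τ[g₁|…|g_p‖k₁|…|k_q] = Σ_{λ ∈ Shuff(p,q)} (-1)^|λ| λ[g₁|…|g_p|k₁|…|k_q]`
as a formal `ℤ`-linear combination of `(p+q)`-tuples. -/
noncomputable def tauBar (p q : ℕ) (gs : Fin p → K) (ks : Fin q → K) :
    ((Fin (p + q) → K) →₀ ℤ) :=
  ∑ σ ∈ Finset.univ.filter (fun σ => IsShuffle p q σ),
    (((Equiv.Perm.sign σ : ℤˣ) : ℤ)) • Finsupp.single (shuffleTuple K p q σ gs ks) 1

/-- Normalized bar `n`-cochains of `K` with coefficients in `M`, realized as the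
bidegree `(n,0)` part. -/
abbrev SC (n : ℕ) : Type := Cpq K K M n 0

/-- Normalized cocycles of the bar cochain complex of `K`. -/
def ZS (n : ℕ) : AddSubgroup (SC K M n) :=
  nrm K K M n 0 ⊓ (dGhom K K MulAut.conj M n 0).ker

/-- Normalized coboundaries of the bar cochain complex of `K`. -/
def BS : ∀ n : ℕ, AddSubgroup (SC K M n)
  | 0 => ⊥
  | n + 1 => AddSubgroup.map (dGhom K K MulAut.conj M n 0) (nrm K K M n 0)

/-- Normalized bar cohomology of `K`. -/
abbrev HS (n : ℕ) := ZS K M n ⧸ (BS K M n).addSubgroupOf (ZS K M n)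


/-- The restricted dual shuffle homomorphism `τ₁∨`, landing in
`Tot^n(A^{*,*}(K ⋊ K, M))` (components with `q > 0`). -/
noncomputable def tauDualA (n : ℕ) (F : SC K M n) : TotA K K M n := fun p x =>
  (tauBar K (p : ℕ) (n - (p : ℕ)) x.1 x.2).sum fun t c =>
    c • F (fun j => t (Fin.cast (by have := p.isLt; omega) j), fun i => i.elim0)

/-- The inclusion `Tot^n(B^{*,*}) → Tot^n(A^{*,*})`. -/
def inclBA (n : ℕ) (b : TotB K K M n) : TotA K K M n := fun p =>
  if h : 1 ≤ (p : ℕ) then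
    castC K K M
      (by
        show ((p : ℕ) - 1) + 1 = (p : ℕ)
        omega)
      (by
        show n - (((p : ℕ) - 1) + 1) = n - (p : ℕ)
        omega)
      (b ⟨(p : ℕ) - 1, by have := p.isLt; omega⟩)
  else 0

/-- The inclusion `Tot^n(A^{*,*}) → Tot^n(C^{*,*})`. -/
def inclAC (n : ℕ) (a : TotA K K M n) : TotC K K M n := fun p =>
  if h : (p : ℕ) < n then a ⟨(p : ℕ), h⟩ else 0

/-- The inclusion of the 0-th row `C^n(K, M) → Tot^n(C^{*,*}(K ⋊ K, M))` (bidegree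
`(n,0)`); under the identification of `Tot^*` with the cochains of `K ⋊ K` this realizes
the pullback `π₂*` along the projection `π₂ : K ⋊ K → K`. -/
def rowE (n : ℕ) (z : SC K M n) : TotC K K M n := fun p =>
  if h : (p : ℕ) = n then
    castC K K M (by omega) (by omega) z
  else 0

section Words

variable {α X N : Type} [Group α] [AddCommGroup N]

/-- The alternating sum of the inner and last faces of a word, where the last face lets the
dropped letter act on the parameter `x`. -/
def innerFaces (act : α → X → X) : (List α → X → N) → List α → X → N
  | _, [], _ => 0
  | Φ, [a], x => Φ [] (act a x)
  | Φ, a :: b :: w, x =>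
      Φ (a * b :: w) x - innerFaces act (fun u y => Φ (a :: u) y) (b :: w) x

/-- The bar differential on functions of words. -/
def barDiff (act : α → X → X) (Φ : List α → X → N) : List α → X → N
  | [], _ => 0
  | a :: w, x => Φ w x - innerFaces act Φ (a :: w) x

lemma innerFaces_add (act : α → X → X) (w : List α) (x : X) (Φ Ψ : List α → X → N) :
    innerFaces act (fun u y => Φ u y + Ψ u y) w x =
      innerFaces act Φ w x + innerFaces act Ψ w x := by
  induction w generalizing Φ Ψ with
  | nil => simp [innerFaces]
  | cons a w ih =>
    cases w with
    | nil => simp [innerFaces]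
    | cons b w => simp only [innerFaces, ih]; abel

lemma innerFaces_zsmul (act : α → X → X) (w : List α) (x : X) (c : ℤ) (Φ : List α → X → N) :
    innerFaces act (fun u y => c • Φ u y) w x = c • innerFaces act Φ w x := by
  induction w generalizing Φ with
  | nil => simp [innerFaces]
  | cons a w ih =>
    cases w with
    | nil => simp [innerFaces]
    | cons b w => simp only [innerFaces, ih, smul_sub]

/-- Faces only see words of length one less, and parameters in an invariant set. -/
lemma innerFaces_congr (act : α → X → X) (P : X → Prop) (hP : ∀ a x, P x → P (act a x))
    (w : List α) (x : X) (hx : P x) (Φ Ψ : List α → X → N)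
    (h : ∀ u y, u.length + 1 = w.length → P y → Φ u y = Ψ u y) :
    innerFaces act Φ w x = innerFaces act Ψ w x := by
  induction w generalizing Φ Ψ with
  | nil => simp [innerFaces]
  | cons a w ih =>
    cases w with
    | nil => exact h _ _ rfl (hP _ _ hx)
    | cons b w =>
      simp only [innerFaces]
      rw [h (a * b :: w) x rfl hx, ih (fun u y => Φ (a :: u) y) (fun u y => Ψ (a :: u) y)]
      intro u y hu hy
      exact h _ _ (by simpa using hu) hy

lemma barDiff_congr (act : α → X → X) (P : X → Prop) (hP : ∀ a x, P x → P (act a x))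
    (w : List α) (x : X) (hx : P x) (Φ Ψ : List α → X → N)
    (h : ∀ u y, u.length + 1 = w.length → P y → Φ u y = Ψ u y) :
    barDiff act Φ w x = barDiff act Ψ w x := by
  cases w with
  | nil => rfl
  | cons a w =>
    simp only [barDiff]
    rw [h _ _ rfl hx, innerFaces_congr act P hP _ x hx Φ Ψ h]

lemma barDiff_add (act : α → X → X) (w : List α) (x : X) (Φ Ψ : List α → X → N) :
    barDiff act (fun u y => Φ u y + Ψ u y) w x = barDiff act Φ w x + barDiff act Ψ w x := by
  cases w with
  | nil => simp [barDiff]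
  | cons a w => simp only [barDiff, innerFaces_add]; abel

/-- The diagonal action on words by conjugation. -/
def conjWord (g : α) (w : List α) : List α := w.map (MulAut.conj g)

/-- The trivial action. -/
def trivAct (_ : α) (x : X) : X := x

/-- The bar differential of functions of words with trivial coefficients. -/
def wordDiff (F : List α → N) (w : List α) : N := barDiff trivAct (fun u (_ : Unit) => F u) w ()

/-- The inner and last faces of functions of words with trivial coefficients. -/
def wordFaces (F : List α → N) (w : List α) : N :=
  innerFaces trivAct (fun u (_ : Unit) => F u) w ()

/-- The signed sum over all shuffles of the words `gs` and `ks`, letters of `ks` being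
conjugated by the letters of `gs` that follow them, defined by recursion on the first letter. -/
def shuffleSum : List α → List α → (List α → N) → N
  | [], ks, F => F ks
  | g :: gs, [], F => F (g :: gs)
  | g :: gs, k :: ks, F =>
      shuffleSum gs (k :: ks) (fun w => F (g :: w)) +
        (-1 : ℤ) ^ (gs.length + 1) •
          shuffleSum (g :: gs) ks (fun w => F (MulAut.conj (g :: gs).prod k :: w))
  termination_by gs ks => gs.length + ks.length

lemma shuffleSum_nil_right (gs : List α) (F : List α → N) : shuffleSum gs [] F = F gs := by
  cases gs <;> simp [shuffleSum]

lemma shuffleSum_add (gs ks : List α) (F F' : List α → N) :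
    shuffleSum gs ks (fun w => F w + F' w) = shuffleSum gs ks F + shuffleSum gs ks F' := by
  induction gs, ks, F using shuffleSum.induct generalizing F' with
  | case1 => simp [shuffleSum]
  | case2 => simp [shuffleSum]
  | case3 g gs k ks F h1 h2 => simp only [shuffleSum, h1, h2, smul_add]; abel

lemma shuffleSum_neg (gs ks : List α) (F : List α → N) :
    shuffleSum gs ks (fun w => - F w) = - shuffleSum gs ks F := by
  induction gs, ks, F using shuffleSum.induct with
  | case1 => simp [shuffleSum]
  | case2 => simp [shuffleSum]
  | case3 g gs k ks F h1 h2 => simp only [shuffleSum, h1, h2, smul_neg]; abel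

lemma shuffleSum_sub (gs ks : List α) (F F' : List α → N) :
    shuffleSum gs ks (fun w => F w - F' w) = shuffleSum gs ks F - shuffleSum gs ks F' := by
  simp only [sub_eq_add_neg, shuffleSum_add, shuffleSum_neg]

lemma shuffleSum_zero (gs ks : List α) : shuffleSum gs ks (fun _ => (0 : N)) = 0 := by
  have := shuffleSum_add gs ks (fun _ => (0 : N)) (fun _ => 0)
  simpa using this

/-- Multiply the first letter of the word by `x` on the left before evaluating `F`. -/
def mulHead (x : α) (F : List α → N) : List α → N
  | [] => F []
  | y :: w => F (x * y :: w)

lemma wordFaces_cons (F : List α → N) (x : α) (w : List α) :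
    wordFaces F (x :: w) = mulHead x F w - wordFaces (fun u => F (x :: u)) w := by
  cases w <;> simp [wordFaces, innerFaces, mulHead]

lemma wordFaces_add (F F' : List α → N) (w : List α) :
    wordFaces (fun u => F u + F' u) w = wordFaces F w + wordFaces F' w :=
  innerFaces_add ..

lemma wordFaces_zsmul (c : ℤ) (F : List α → N) (w : List α) :
    wordFaces (fun u => c • F u) w = c • wordFaces F w :=
  innerFaces_zsmul ..

lemma innerFaces_conj_split (A : List α → List α → N) (B : α → List α → List α → N)
    (Ξ : List α → List α → N)
    (h : ∀ u k v, Ξ u (k :: v) =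
      A u (k :: v) + (-1 : ℤ) ^ (u.length + 1) • B (MulAut.conj u.prod k) u v)
    (gs : List α) (k : α) (ks : List α) :
    innerFaces conjWord Ξ gs (k :: ks) = innerFaces conjWord A gs (k :: ks) +
      (-1 : ℤ) ^ gs.length • innerFaces conjWord (B (MulAut.conj gs.prod k)) gs ks := by
  induction gs generalizing A B Ξ with
  | nil => simp [innerFaces]
  | cons a gs ih =>
    cases gs with
    | nil => simp [innerFaces, conjWord, h]
    | cons b gs =>
      simp only [innerFaces]
      rw [ih (fun u y => A (a :: u) y)
        (fun k' u v => (-1 : ℤ) • B (MulAut.conj a k') (a :: u) v)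
        (fun u y => Ξ (a :: u) y), h, innerFaces_zsmul]
      · simp only [List.prod_cons, List.length_cons, map_mul, MulAut.mul_apply, smul_sub, pow_succ,
          mul_neg, mul_one, neg_neg, neg_smul, one_smul, smul_neg]
        abel
      · intro u k v
        simp only [h, List.prod_cons, List.length_cons, map_mul, MulAut.mul_apply, pow_succ,
          mul_neg, mul_one, neg_neg, neg_smul, one_smul, smul_neg]

lemma mulHead_cons_right (g k : α) (gs ks : List α) (F : List α → N) :
    shuffleSum gs (k :: ks) (mulHead g F) =
      (match gs with
        | [] => 0
        | b :: gs' => shuffleSum gs' (k :: ks) (fun w => F (g * b :: w))) +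
      (-1 : ℤ) ^ gs.length •
        shuffleSum gs ks (fun w => F (g * MulAut.conj gs.prod k :: w)) := by
  cases gs <;> simp [shuffleSum, mulHead]

lemma mulHead_cons_left (c g : α) (gs ks : List α) (F : List α → N) :
    shuffleSum (g :: gs) ks (mulHead c F) =
      shuffleSum gs ks (fun w => F (c * g :: w)) +
      (match ks with
        | [] => 0
        | b :: ks' => (-1 : ℤ) ^ (gs.length + 1) •
            shuffleSum (g :: gs) ks' (fun w => F (c * MulAut.conj (g :: gs).prod b :: w))) := by
  cases ks <;> simp [shuffleSum, mulHead, shuffleSum_nil_right]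

lemma innerFaces_const (act : α → X → X) (F : List α → N) (w : List α) (x : X) :
    innerFaces act (fun u _ => F u) w x = wordFaces F w := by
  induction w generalizing F with
  | nil => simp [innerFaces, wordFaces]
  | cons a w ih =>
    cases w with
    | nil => simp [innerFaces, wordFaces]
    | cons b w =>
      rw [wordFaces_cons, ← ih]
      simp [innerFaces, mulHead]

lemma innerFaces_shuffleSum_cons (g k : α) (gs ks : List α) (F : List α → N) :
    innerFaces conjWord (fun u v => shuffleSum u v F) (g :: gs) (k :: ks) =
      (match gs with
        | [] => 0
        | b :: gs' => shuffleSum gs' (k :: ks) (fun w => F (g * b :: w))) -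
      innerFaces conjWord (fun u v => shuffleSum u v (fun w => F (g :: w))) gs (k :: ks) +
      (-1 : ℤ) ^ gs.length • innerFaces conjWord
        (fun u v => shuffleSum u v (fun w => F (MulAut.conj (g :: gs).prod k :: w)))
        (g :: gs) ks := by
  rw [innerFaces_conj_split
    (fun u v => match u with
      | [] => 0
      | a :: u' => shuffleSum u' v (fun w => F (a :: w)))
    (fun c u v => (-1 : ℤ) • shuffleSum u v (fun w => F (c :: w)))]
  · rw [innerFaces_zsmul]
    cases gs with
    | nil => simp [innerFaces]
    | cons b gs => simp only [innerFaces, List.length_cons, pow_succ, mul_neg, mul_one, neg_neg,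
        neg_smul, one_smul, smul_neg]
  · rintro (_ | ⟨a, u⟩) k v <;> simp [shuffleSum, pow_succ]

/-- Compatibility of the shuffle sum with the inner and last faces. -/
theorem shuffleSum_wordFaces (gs ks : List α) (F : List α → N) :
    shuffleSum gs ks (wordFaces F) =
      innerFaces conjWord (fun u v => shuffleSum u v F) gs ks +
        (-1 : ℤ) ^ gs.length • wordFaces (fun v => shuffleSum gs v F) ks := by
  induction gs, ks, F using shuffleSum.induct with
  | case1 ks F => simp [shuffleSum, innerFaces]
  | case2 g gs F =>
    rw [innerFaces_congr conjWord (fun y => y = []) (by rintro _ _ rfl; rfl) _ _ rfl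
      (fun u v => shuffleSum u v F) (fun u _ => F u), innerFaces_const]
    · simp [wordFaces, innerFaces, shuffleSum]
    · rintro u y - rfl; rw [shuffleSum_nil_right]
  | case3 g gs k ks F h1 h2 =>
    have hc : MulAut.conj (g :: gs).prod k * g = g * MulAut.conj gs.prod k := by
      simp [mul_assoc]
    rw [innerFaces_shuffleSum_cons, wordFaces_cons, shuffleSum]
    simp only [wordFaces_cons, shuffleSum_sub]
    rw [h1, h2, mulHead_cons_left, mulHead_cons_right, wordFaces_cons, hc]
    simp only [shuffleSum]
    rw [wordFaces_add, wordFaces_zsmul]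
    have hs : ∀ x : N, (-1 : ℤ) ^ gs.length • (-1 : ℤ) ^ gs.length • x = x := by
      intro x; rw [smul_smul, ← mul_pow]; simp
    cases ks with
    | nil =>
      simp only [mulHead, shuffleSum_nil_right, List.length_cons, add_zero, pow_succ, mul_neg,
        mul_one, neg_smul, smul_add, smul_sub, smul_neg, hs]
      abel
    | cons k' ks =>
      simp only [mulHead, shuffleSum, List.length_cons, pow_succ, mul_neg, map_mul,
        mul_one, neg_smul, smul_add, smul_sub, smul_neg, hs]
      abel

/-- The total differential on functions of pairs of words. -/
def pairDiff (Φ : List α → List α → N) (gs ks : List α) : N :=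
  barDiff conjWord Φ gs ks + (-1 : ℤ) ^ gs.length • wordDiff (Φ gs) ks

/-- The dual shuffle map is a cochain map. -/
theorem pairDiff_shuffleSum (gs ks : List α) (F : List α → N) :
    pairDiff (fun u v => shuffleSum u v F) gs ks = shuffleSum gs ks (wordDiff F) := by
  have hd : ∀ x w, wordDiff F (x :: w) = F w - wordFaces F (x :: w) := fun _ _ => rfl
  have h := shuffleSum_wordFaces gs ks F
  rcases gs with _ | ⟨g, gs⟩
  · simp [pairDiff, barDiff, shuffleSum]
  rcases ks with _ | ⟨k, ks⟩
  · have h0 : ∀ G : List α → N, wordDiff G [] = 0 := fun _ => rfl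
    have h1 : ∀ G : List α → N, wordFaces G [] = 0 := fun _ => rfl
    simp only [shuffleSum_nil_right, h1, smul_zero, add_zero] at h
    simp only [pairDiff, barDiff, shuffleSum_nil_right, h0, hd, h, smul_zero, add_zero]
  · have hd' : ∀ G : List α → N, wordDiff G (k :: ks) = G ks - wordFaces G (k :: ks) :=
      fun _ => rfl
    simp only [pairDiff, hd', barDiff]
    rw [shuffleSum] at h ⊢
    simp only [hd, shuffleSum_sub]
    simp only [smul_sub]
    rw [sub_add_sub_comm, sub_add_sub_comm, h]
    simp [List.length_cons]

lemma shuffleSum_eq_zero (gs ks : List α) (F : List α → N) (hF : ∀ w, 1 ∈ w → F w = 0)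
    (h : 1 ∈ gs ∨ 1 ∈ ks) : shuffleSum gs ks F = 0 := by
  induction gs, ks, F using shuffleSum.induct with
  | case1 ks F => rw [shuffleSum]; exact hF _ (by simpa using h)
  | case2 g gs F => rw [shuffleSum]; exact hF _ (by simpa using h)
  | case3 g gs k ks F h1 h2 =>
    have key : ∀ u v x, (x ≠ 1 → shuffleSum u v (fun w => F (x :: w)) = 0) →
        shuffleSum u v (fun w => F (x :: w)) = 0 := by
      intro u v x H
      by_cases hx : x = 1
      · simp [hx, hF, shuffleSum_zero]
      · exact H hx
    rw [shuffleSum, key gs (k :: ks) g, key (g :: gs) ks]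
    · simp
    · intro hk
      refine h2 (fun w hw => hF _ (by simp [hw])) ?_
      rcases h with h | h
      · exact .inl h
      · rcases List.mem_cons.1 h with h | h
        · exact absurd (by rw [← h]; simp) hk
        · exact .inr h
    · intro hg
      refine h1 (fun w hw => hF _ (by simp [hw])) ?_
      rcases h with h | h
      · rcases List.mem_cons.1 h with h | h
        · exact absurd h.symm hg
        · exact .inl h
      · exact .inr h

end Words
section Riffle

open Equiv

variable {N : ℕ}

/-- The permutation sending `0` to `a` and restricting to `e` on the remaining letters. -/
def insertFirst (a : Fin (N + 1)) (e : Perm (Fin N)) : Perm (Fin (N + 1)) :=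
  a.cycleRange.symm * Perm.decomposeFin.symm (0, e)

@[simp] lemma insertFirst_zero (a : Fin (N + 1)) (e : Perm (Fin N)) : insertFirst a e 0 = a := by
  simp [insertFirst]

@[simp] lemma insertFirst_succ (a : Fin (N + 1)) (e : Perm (Fin N)) (j : Fin N) :
    insertFirst a e j.succ = a.succAbove (e j) := by
  simp [insertFirst]

lemma sign_insertFirst (a : Fin (N + 1)) (e : Perm (Fin N)) :
    ((Perm.sign (insertFirst a e) : ℤˣ) : ℤ) = (-1) ^ (a : ℕ) * (Perm.sign e : ℤˣ) := by
  simp [insertFirst]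

lemma insertFirst_bijective :
    Function.Bijective (fun x : Fin (N + 1) × Perm (Fin N) => insertFirst x.1 x.2) := by
  rw [Fintype.bijective_iff_injective_and_card]
  constructor
  · rintro ⟨a, e⟩ ⟨b, f⟩ h
    have h0 := DFunLike.congr_fun h 0
    simp only [insertFirst_zero] at h0
    subst h0
    have := (Perm.decomposeFin.symm.injective (mul_left_cancel h))
    simpa using this
  · simp [Fintype.card_perm, Nat.factorial_succ]

/-- `τ` lists the letters of a shuffle of the letters `< p` with the letters `≥ p`. -/
def IsRiffle (p : ℕ) (τ : Perm (Fin N)) : Prop :=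
  ∀ x y, τ x < τ y → ((τ y : ℕ) < p ∨ p ≤ (τ x : ℕ)) → x < y

lemma isRiffle_insertFirst_zero (p : ℕ) (e : Perm (Fin N)) :
    IsRiffle (p + 1) (insertFirst 0 e) ↔ IsRiffle p e := by
  constructor
  · intro h x y hxy hp
    have := h x.succ y.succ (by simpa using hxy) (by simpa using hp)
    simpa using this
  · intro h x y
    refine Fin.cases ?_ (fun x => ?_) x <;> refine Fin.cases ?_ (fun y => ?_) y
    · simp
    · simp
    · simp
    · simpa using h x y

lemma isRiffle_insertFirst_self (p : ℕ) (a : Fin (N + 1)) (ha : (a : ℕ) = p) (e : Perm (Fin N)) :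
    IsRiffle p (insertFirst a e) ↔ IsRiffle p e := by
  subst ha
  have hv : ∀ i : Fin N, (a.succAbove i : ℕ) = if (i : ℕ) < a then (i : ℕ) else i + 1 := by
    intro i
    simp only [Fin.succAbove, Fin.lt_def, Fin.val_castSucc]
    split_ifs <;> simp
  constructor
  · intro h x y hxy hp
    have := h x.succ y.succ (by simpa using hxy) (by
      simp only [insertFirst_succ, hv]; split_ifs <;> omega)
    simpa using this
  · intro h x y
    refine Fin.cases ?_ (fun x => ?_) x <;> refine Fin.cases ?_ (fun y => ?_) y
    · simp
    · simp
    · simp only [insertFirst_succ, insertFirst_zero, Fin.lt_def, hv]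
      split_ifs <;> omega
    · intro h1 h2
      have := h x y (by simpa using h1) (by
        simp only [insertFirst_succ, hv] at h2; split_ifs at h2 <;> omega)
      simpa using this

lemma IsRiffle.first {p : ℕ} {a : Fin (N + 1)} {e : Perm (Fin N)}
    (h : IsRiffle p (insertFirst a e)) : (a = 0 ∧ 0 < p) ∨ (a : ℕ) = p := by
  by_contra hc
  push Not at hc
  obtain ⟨h1, h2⟩ := hc
  rcases lt_or_ge (a : ℕ) p with hap | hap
  · have ha : a ≠ 0 := fun ha => by have := h1 ha; omega
    have := h ((insertFirst a e).symm 0) 0 (by simpa using Fin.pos_of_ne_zero ha)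
      (by simp [hap])
    simp at this
  · have := h ((insertFirst a e).symm ⟨p, by omega⟩) 0
      (by simp [Fin.lt_def]; omega) (by simp)
    simp at this

lemma IsRiffle.le {p : ℕ} {e : Perm (Fin N)} (h : IsRiffle p e) (m : ℕ) (j : Fin N)
    (hj : (e j : ℕ) = p + m) : m ≤ j := by
  induction m generalizing j with
  | zero => simp
  | succ m ih =>
    have hb := (e j).isLt
    have h1 := ih (e.symm ⟨p + m, by omega⟩) (by simp)
    have h2 := h (e.symm ⟨p + m, by omega⟩) j (by simp [Fin.lt_def]; omega) (by simp)
    rw [Fin.lt_def] at h2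
    omega

variable {α M : Type} [Group α] [AddCommGroup M]

/-- The word of the riffle `τ` of `gs` and `ks`. -/
def riffleWord (gs ks : List α) (τ : Perm (Fin N)) : List α :=
  List.ofFn fun j : Fin N =>
    if (τ j : ℕ) < gs.length then gs.getD (τ j) 1
    else MulAut.conj (gs.drop (gs.length + j - τ j)).prod (ks.getD (τ j - gs.length) 1)

lemma riffleWord_insertFirst_zero (g : α) (gs ks : List α) (e : Perm (Fin N))
    (he : IsRiffle gs.length e) :
    riffleWord (g :: gs) ks (insertFirst 0 e) = g :: riffleWord gs ks e := by
  rw [riffleWord, List.ofFn_succ, riffleWord]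
  congr 2
  funext j
  simp only [insertFirst_succ, Fin.zero_succAbove, Fin.val_succ, List.length_cons,
    add_lt_add_iff_right, List.getD_cons_succ, Nat.add_sub_add_right]
  split_ifs with hj
  · rfl
  · have := he.le ((e j : ℕ) - gs.length) j (by omega)
    rw [show gs.length + 1 + (j + 1) - ((e j : ℕ) + 1) = (gs.length + j - e j) + 1 by omega,
      List.drop_succ_cons]

lemma riffleWord_insertFirst_length (gs : List α) (k : α) (ks : List α) (a : Fin (N + 1))
    (ha : (a : ℕ) = gs.length) (e : Perm (Fin N)) :
    riffleWord gs (k :: ks) (insertFirst a e) =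
      MulAut.conj gs.prod k :: riffleWord gs ks e := by
  have hv : ∀ i : Fin N, (a.succAbove i : ℕ) = if (i : ℕ) < a then (i : ℕ) else i + 1 := by
    intro i
    simp only [Fin.succAbove, Fin.lt_def, Fin.val_castSucc]
    split_ifs <;> simp
  rw [riffleWord, List.ofFn_succ, riffleWord]
  congr 1
  · simp [ha]
  · congr 1
    funext j
    simp only [insertFirst_succ, hv, ha, Fin.val_succ]
    by_cases hj : (e j : ℕ) < gs.length
    · simp [hj]
    · have h1 : ¬ ((e j : ℕ) + 1 < gs.length) := by omega
      have h2 : (e j : ℕ) + 1 - gs.length = ((e j : ℕ) - gs.length) + 1 := by omega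
      have h3 : gs.length + ((j : ℕ) + 1) - ((e j : ℕ) + 1) = gs.length + j - e j := by omega
      simp only [hj, if_false, h1, h2, h3, List.getD_cons_succ]

open scoped Classical in
/-- The signed sum over all riffles is the recursively defined shuffle sum. -/
theorem sum_riffle (gs ks : List α) (hN : N = gs.length + ks.length) (F : List α → M) :
    ∑ τ : Perm (Fin N), (if IsRiffle gs.length τ then
      ((Perm.sign τ : ℤˣ) : ℤ) • F (riffleWord gs ks τ) else 0) = shuffleSum gs ks F := by
  induction N generalizing gs ks F with
  | zero =>
    obtain rfl : gs = [] := List.eq_nil_of_length_eq_zero (by omega)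
    obtain rfl : ks = [] := List.eq_nil_of_length_eq_zero (by omega)
    have h : ∀ τ : Perm (Fin 0), IsRiffle 0 τ := fun τ x => x.elim0
    simp [shuffleSum, riffleWord, h]
  | succ N ih =>
    rw [← insertFirst_bijective.sum_comp, Fintype.sum_prod_type]
    have h0 : ∀ g gs', gs = g :: gs' →
        ∑ e : Perm (Fin N), (if IsRiffle gs.length (insertFirst 0 e) then
          ((Perm.sign (insertFirst 0 e) : ℤˣ) : ℤ) • F (riffleWord gs ks (insertFirst 0 e)) else 0)
          = shuffleSum gs' ks (fun w => F (g :: w)) := by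
      rintro g gs' rfl
      rw [← ih gs' ks (by simp at hN; omega)]
      refine Finset.sum_congr rfl fun e _ => ?_
      simp only [List.length_cons, isRiffle_insertFirst_zero]
      split_ifs with he
      · rw [riffleWord_insertFirst_zero _ _ _ _ he, sign_insertFirst]; simp
      · rfl
    have h1 : ∀ k ks' (a : Fin (N + 1)), ks = k :: ks' → (a : ℕ) = gs.length →
        ∑ e : Perm (Fin N), (if IsRiffle gs.length (insertFirst a e) then
          ((Perm.sign (insertFirst a e) : ℤˣ) : ℤ) • F (riffleWord gs ks (insertFirst a e)) else 0)
          = (-1 : ℤ) ^ gs.length • shuffleSum gs ks' (fun w => F (MulAut.conj gs.prod k :: w)) := by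
      rintro k ks' a rfl ha
      rw [← ih gs ks' (by simp at hN; omega), Finset.smul_sum]
      refine Finset.sum_congr rfl fun e _ => ?_
      simp only [isRiffle_insertFirst_self _ _ ha]
      split_ifs with he
      · rw [riffleWord_insertFirst_length _ _ _ _ ha, sign_insertFirst, ha, mul_smul]
      · simp
    have h2 : ∀ a : Fin (N + 1), ¬ (a = 0 ∧ 0 < gs.length) → (a : ℕ) ≠ gs.length →
        ∑ e : Perm (Fin N), (if IsRiffle gs.length (insertFirst a e) then
          ((Perm.sign (insertFirst a e) : ℤˣ) : ℤ) • F (riffleWord gs ks (insertFirst a e)) else 0)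
          = 0 := by
      intro a ha hb
      refine Finset.sum_eq_zero fun e _ => if_neg fun he => ?_
      rcases he.first with h | h
      · exact ha h
      · exact hb h
    rcases gs with _ | ⟨g, gs⟩
    · rcases ks with _ | ⟨k, ks⟩
      · simp at hN
      rw [Finset.sum_eq_single 0]
      · rw [h1 k ks 0 rfl rfl]
        simp only [shuffleSum, List.length_nil, pow_zero, one_smul, List.prod_nil, map_one,
          MulAut.one_apply]
      · intro a _ ha
        exact h2 a (by simp) (fun h => ha (Fin.ext h))
      · simp
    · rcases ks with _ | ⟨k, ks⟩
      · rw [Finset.sum_eq_single 0]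
        · rw [h0 g gs rfl]; simp [shuffleSum_nil_right]
        · intro a _ ha
          refine h2 a (fun h => ha h.1) (fun h => ?_)
          have := a.isLt
          simp at hN h
          omega
        · simp
      · have hlt : gs.length + 1 < N + 1 := by simp at hN; omega
        rw [Finset.sum_eq_add (0 : Fin (N + 1)) ⟨gs.length + 1, hlt⟩]
        · rw [h0 g gs rfl, h1 k ks _ rfl rfl, shuffleSum]; simp
        · simp [Fin.ext_iff]
        · intro a _ ha
          exact h2 a (fun h => ha.1 h.1) (fun h => ha.2 (Fin.ext h))
        · simp
        · simp

end Riffle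

section Tuples

variable {α M X : Type} [Group α] [AddCommGroup M]

lemma ofFn_mergeD_zero {p : ℕ} (h : Fin (p + 2) → α) :
    List.ofFn (mergeD 0 h) = h 0 * h 1 :: List.ofFn (fun j : Fin p => h j.succ.succ) := by
  rw [List.ofFn_succ]
  simp [mergeD]

lemma ofFn_mergeD_succ {p : ℕ} (i : ℕ) (h : Fin (p + 2) → α) :
    List.ofFn (mergeD (i + 1) h) = h 0 :: List.ofFn (mergeD i (fun j => h j.succ)) := by
  rw [List.ofFn_succ]
  congr 2
  funext j
  simp [mergeD]

lemma innerFaces_ofFn (act : α → X → X) {p : ℕ} (h : Fin (p + 1) → α) (x : X)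
    (Φ : List α → X → M) :
    innerFaces act Φ (List.ofFn h) x =
      ∑ i ∈ Finset.range p, (-1 : ℤ) ^ i • Φ (List.ofFn (mergeD i h)) x +
        (-1 : ℤ) ^ p • Φ (List.ofFn fun j : Fin p => h j.castSucc) (act (h (Fin.last p)) x) := by
  induction p generalizing Φ with
  | zero => simp [innerFaces]
  | succ p ih =>
    have := ih (fun j => h j.succ) (fun u y => Φ (h 0 :: u) y)
    rw [List.ofFn_succ] at this
    rw [List.ofFn_succ, List.ofFn_succ, innerFaces, this, Finset.sum_range_succ',
      ofFn_mergeD_zero]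
    simp only [ofFn_mergeD_succ, pow_succ, mul_neg, mul_one, neg_smul, Finset.sum_neg_distrib,
      pow_zero, one_smul]
    rw [List.ofFn_succ (f := fun j : Fin (p + 1) => h j.castSucc)]
    simp only [Fin.succ_last, Fin.succ_castSucc, Fin.castSucc_zero, Fin.succ_zero_eq_one]
    abel

lemma barDiff_ofFn (act : α → X → X) {p : ℕ} (h : Fin (p + 1) → α) (x : X)
    (Φ : List α → X → M) :
    barDiff act Φ (List.ofFn h) x =
      Φ (List.ofFn fun j : Fin p => h j.succ) x +
        ∑ i ∈ Finset.range p, (-1 : ℤ) ^ (i + 1) • Φ (List.ofFn (mergeD i h)) x +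
        (-1 : ℤ) ^ (p + 1) •
          Φ (List.ofFn fun j : Fin p => h j.castSucc) (act (h (Fin.last p)) x) := by
  have := innerFaces_ofFn act h x Φ
  rw [List.ofFn_succ] at this ⊢
  rw [barDiff, this]
  simp only [pow_succ, mul_neg, mul_one, neg_smul, Finset.sum_neg_distrib]
  abel

/-- The cochain of bidegree `(p, q)` given by a function of pairs of words. -/
def tup (p q : ℕ) (Φ : List α → List α → M) : Cpq α α M p q :=
  fun x => Φ (List.ofFn x.1) (List.ofFn x.2)

lemma dGhom_tup (p q : ℕ) (Φ : List α → List α → M) :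
    dGhom α α MulAut.conj M p q (tup p q Φ) = tup (p + 1) q (barDiff conjWord Φ) := by
  funext x
  simp only [dGhom, AddMonoidHom.mk'_apply, dGfun, tup, barDiff_ofFn, conjWord, List.map_ofFn]
  rfl

lemma dKhom_tup (p q : ℕ) (Φ : List α → List α → M) :
    dKhom α α M p q (tup p q Φ) = tup p (q + 1) (fun gs => wordDiff (Φ gs)) := by
  funext x
  simp only [dKhom, AddMonoidHom.mk'_apply, dKfun, tup, wordDiff, barDiff_ofFn]

lemma castC_tup {p q p' q' : ℕ} (h1 : p = p') (h2 : q = q') (Φ : List α → List α → M) :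
    castC α α M h1 h2 (tup p q Φ) = tup p' q' Φ := by
  subst h1 h2; rfl

/-- A function of pairs of words inducing a given cochain. -/
def liftWords {p q : ℕ} (F : Cpq α α M p q) (gs ks : List α) : M :=
  if h : gs.length = p ∧ ks.length = q then
    F (fun i => gs.get (i.cast h.1.symm), fun i => ks.get (i.cast h.2.symm))
  else 0

lemma tup_liftWords {p q : ℕ} (F : Cpq α α M p q) : tup p q (liftWords F) = F := by
  funext x
  simp [tup, liftWords]

lemma liftWords_eq_zero {p q : ℕ} (F : Cpq α α M p q) (hF : F ∈ nrm α α M p q) (gs ks : List α)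
    (h : 1 ∈ gs ∨ 1 ∈ ks) : liftWords F gs ks = 0 := by
  unfold liftWords
  split_ifs with hl
  · obtain ⟨rfl, rfl⟩ := hl
    refine hF _ (h.imp (fun h => ?_) (fun h => ?_)) <;>
    · obtain ⟨i, hi⟩ := List.mem_iff_get.1 h
      exact ⟨i, hi⟩
  · rfl

lemma tup_mem_nrm (p q : ℕ) (Φ : List α → List α → M)
    (hΦ : ∀ gs ks, 1 ∈ gs ∨ 1 ∈ ks → Φ gs ks = 0) : tup p q Φ ∈ nrm α α M p q := by
  intro x hx
  refine hΦ _ _ (hx.imp ?_ ?_) <;> rintro ⟨i, hi⟩ <;> rw [← hi] <;> simp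

/-- The total cochain given by a function of pairs of words. -/
def tupC (n : ℕ) (Φ : List α → List α → M) : TotC α α M n := fun p => tup p (n - p) Φ

/-- The total cochain of the double complex without 0-th row and column given by a function of
pairs of words. -/
def tupB (n : ℕ) (Φ : List α → List α → M) : TotB α α M n := fun p => tup (p + 1) (n - (p + 1)) Φ

lemma exists_tupC (n : ℕ) (y : TotC α α M n) : ∃ Φ : List α → List α → M, tupC n Φ = y ∧
    (y ∈ nrmC α α M n → ∀ gs ks, 1 ∈ gs ∨ 1 ∈ ks → Φ gs ks = 0) := by
  refine ⟨fun gs ks => if h : gs.length < n + 1 then liftWords (y ⟨_, h⟩) gs ks else 0, ?_, ?_⟩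
  · funext p x
    have key : ∀ l : List α, l.length = p → ∀ ks : List α,
        (if h : l.length < n + 1 then liftWords (y ⟨_, h⟩) l ks else 0) =
          liftWords (y p) l ks := by
      intro l hl ks
      have hp : l.length < n + 1 := by have := p.isLt; omega
      have he : (⟨_, hp⟩ : Fin (n + 1)) = p := Fin.ext hl
      rw [dif_pos hp, he]
    exact (key _ (by simp) _).trans (congrFun (tup_liftWords (y p)) x)
  · intro hy gs ks h
    dsimp only
    split_ifs with hl
    · exact liftWords_eq_zero _ (hy _ (Set.mem_univ _)) _ _ h
    · rfl

lemma exists_tupB (n : ℕ) (y : TotB α α M n) : ∃ Φ : List α → List α → M, tupB n Φ = y ∧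
    (y ∈ nrmB α α M n → ∀ gs ks, 1 ∈ gs ∨ 1 ∈ ks → Φ gs ks = 0) := by
  refine ⟨fun gs ks => if h : gs.length - 1 < n - 1 then liftWords (y ⟨_, h⟩) gs ks else 0,
    ?_, ?_⟩
  · funext p x
    have key : ∀ l : List α, l.length = p + 1 → ∀ ks : List α,
        (if h : l.length - 1 < n - 1 then liftWords (y ⟨_, h⟩) l ks else 0) =
          liftWords (y p) l ks := by
      intro l hl ks
      have hp : l.length - 1 < n - 1 := by have := p.isLt; omega
      have he : (⟨_, hp⟩ : Fin (n - 1)) = p := Fin.ext (by simp [hl])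
      rw [dif_pos hp, he]
    exact (key _ (by simp) _).trans (congrFun (tup_liftWords (y p)) x)
  · intro hy gs ks h
    dsimp only
    split_ifs with hl
    · exact liftWords_eq_zero _ (hy _ (Set.mem_univ _)) _ _ h
    · rfl

lemma totd_tupC (n : ℕ) (Φ : List α → List α → M) :
    totd α α MulAut.conj M n (tupC n Φ) = tupC (n + 1) (pairDiff Φ) := by
  funext p x
  have h1 : (if h1 : 1 ≤ (p : ℕ) then
      castC α α M (by omega) (by have := p.isLt; omega)
        (dGhom α α MulAut.conj M ((p : ℕ) - 1) (n - ((p : ℕ) - 1))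
          (tup ((p : ℕ) - 1) (n - ((p : ℕ) - 1)) Φ))
      else 0) = tup (p : ℕ) (n + 1 - (p : ℕ)) (barDiff conjWord Φ) := by
    split_ifs with h
    · rw [dGhom_tup, castC_tup]
    · funext x
      have : List.ofFn x.1 = [] := List.eq_nil_of_length_eq_zero (by rw [List.length_ofFn]; omega)
      simp [tup, this, barDiff]
  have h2 : (if h2 : (p : ℕ) ≤ n then
      castC α α M rfl (by omega) (dKhom α α M (p : ℕ) (n - (p : ℕ)) (tup (p : ℕ) (n - (p : ℕ)) Φ))
      else 0) = tup (p : ℕ) (n + 1 - (p : ℕ)) (fun gs => wordDiff (Φ gs)) := by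
    split_ifs with h
    · rw [dKhom_tup, castC_tup]
    · funext x
      have : List.ofFn x.2 = [] := List.eq_nil_of_length_eq_zero (by rw [List.length_ofFn]; omega)
      simp [tup, this, barDiff, wordDiff]
  have h3 := congrFun (congrArg₂ (fun A B => A + (-1 : ℤ) ^ (p : ℕ) • B) h1 h2) x
  refine Eq.trans h3 ?_
  simp [tup, tupC, pairDiff]

lemma wordDiff_singleton (F : List α → M) (k : α) : wordDiff F [k] = 0 := by
  simp [wordDiff, barDiff, innerFaces]

/-- Kill the cochains on the 0-th column. -/
def offCol (Φ : List α → List α → M) (gs ks : List α) : M :=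
  match gs with
  | [] => 0
  | g :: gs => Φ (g :: gs) ks

/-- Kill the cochains on the 0-th row. -/
def offRow (Φ : List α → List α → M) (gs ks : List α) : M :=
  match ks with
  | [] => 0
  | k :: ks => Φ gs (k :: ks)

/-- Extend a function of words by zero from the 0-th row. -/
def onRow (F : List α → M) (gs ks : List α) : M :=
  match ks with
  | [] => F gs
  | _ :: _ => 0

lemma tupB_offCol (n : ℕ) (Φ : List α → List α → M) : tupB n (offCol Φ) = tupB n Φ := by
  funext p x
  simp [tupB, tup, offCol, List.ofFn_succ]

lemma totdB_tupB (n : ℕ) (Φ : List α → List α → M) (hΦ : ∀ ks, Φ [] ks = 0) :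
    totdB α α MulAut.conj M n (tupB n Φ) = tupB (n + 1) (pairDiff Φ) := by
  funext p x
  have h1 : (if h1 : 1 ≤ (p : ℕ) then
      castC α α M (by omega) (by have := p.isLt; omega)
        (dGhom α α MulAut.conj M ((p : ℕ) - 1 + 1) (n - ((p : ℕ) - 1 + 1))
          (tup ((p : ℕ) - 1 + 1) (n - ((p : ℕ) - 1 + 1)) Φ))
      else 0) = tup ((p : ℕ) + 1) (n + 1 - ((p : ℕ) + 1)) (barDiff conjWord Φ) := by
    split_ifs with h
    · rw [dGhom_tup, castC_tup]
    · funext x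
      obtain ⟨a, ha⟩ := List.length_eq_one_iff.1 (show (List.ofFn x.1).length = 1 by simp; omega)
      simp only [tup, ha, barDiff, hΦ, innerFaces, sub_zero, Pi.zero_apply]
  have h2 : (if h2 : (p : ℕ) < n - 1 then
      castC α α M rfl (by omega)
        (dKhom α α M ((p : ℕ) + 1) (n - ((p : ℕ) + 1)) (tup ((p : ℕ) + 1) (n - ((p : ℕ) + 1)) Φ))
      else 0) = tup ((p : ℕ) + 1) (n + 1 - ((p : ℕ) + 1)) (fun gs => wordDiff (Φ gs)) := by
    split_ifs with h
    · rw [dKhom_tup, castC_tup]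
    · funext x
      obtain ⟨a, ha⟩ := List.length_eq_one_iff.1
        (show (List.ofFn x.2).length = 1 by have := p.isLt; simp; omega)
      simp only [tup, ha, wordDiff_singleton, Pi.zero_apply]
  have h3 := congrFun (congrArg₂ (fun A B => A + (-1 : ℤ) ^ ((p : ℕ) + 1) • B) h1 h2) x
  refine Eq.trans h3 ?_
  simp [tup, tupB, pairDiff]

lemma wordDiff_congr (F F' : List α → M) (w : List α)
    (h : ∀ u, u.length + 1 = w.length → F u = F' u) : wordDiff F w = wordDiff F' w :=
  barDiff_congr trivAct (fun _ => True) (fun _ _ h => h) w () trivial _ _ fun u _ hu _ => h u hu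

lemma pairDiff_add (Φ Ψ : List α → List α → M) :
    pairDiff (Φ + Ψ) = pairDiff Φ + pairDiff Ψ := by
  funext gs ks
  have h1 := barDiff_add conjWord gs ks Φ Ψ
  have h2 := barDiff_add trivAct ks () (fun u _ => Φ gs u) (fun u _ => Ψ gs u)
  simp only [pairDiff, wordDiff, Pi.add_apply]
  rw [h2, show Φ + Ψ = fun u y => Φ u y + Ψ u y from rfl, h1, smul_add]
  abel

lemma barDiff_zero (act : α → X → X) (w : List α) (x : X) :
    barDiff act (fun _ _ => (0 : M)) w x = 0 := by
  simpa using barDiff_add act w x (fun _ _ => (0 : M)) (fun _ _ => 0)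

lemma barDiff_const (act : α → X → X) (F : List α → M) (w : List α) (x : X) :
    barDiff act (fun u _ => F u) w x = wordDiff F w := by
  cases w with
  | nil => rfl
  | cons a w => rw [barDiff, innerFaces_const]; rfl

lemma pairDiff_offRow (Φ : List α → List α → M) :
    pairDiff (offRow Φ) = offRow (pairDiff Φ) := by
  funext gs ks
  rcases ks with _ | ⟨k, ks⟩
  · rw [pairDiff, barDiff_congr conjWord (fun y => y = []) (by rintro _ _ rfl; rfl) _ _ rfl
      (offRow Φ) (fun _ _ => 0) (by rintro u y - rfl; rfl), barDiff_zero]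
    simp [wordDiff, barDiff, offRow]
  · simp only [pairDiff, offRow]
    rw [barDiff_congr conjWord (fun y => y ≠ []) (by intro a y; simp [conjWord]) _ _ (by simp)
      (offRow Φ) Φ]
    · congr 2
      rcases ks with _ | ⟨k', ks⟩
      · simp [wordDiff_singleton]
      · refine wordDiff_congr _ _ _ ?_
        rintro (_ | ⟨a, u⟩) hu
        · simp at hu
        · rfl
    · rintro u (_ | ⟨a, y⟩) - hy
      · simp at hy
      · rfl

lemma pairDiff_onRow (F : List α → M) :
    pairDiff (onRow F) = onRow (wordDiff F) := by
  funext gs ks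
  rcases ks with _ | ⟨k, ks⟩
  · rw [pairDiff, barDiff_congr conjWord (fun y => y = []) (by rintro _ _ rfl; rfl) _ _ rfl
      (onRow F) (fun u _ => F u) (by rintro u y - rfl; rfl), barDiff_const]
    simp [wordDiff, barDiff, onRow]
  · rw [pairDiff, barDiff_congr conjWord (fun y => y ≠ []) (by intro a y; simp [conjWord]) _ _
      (by simp) (onRow F) (fun _ _ => 0), barDiff_zero]
    · rcases ks with _ | ⟨k', ks⟩
      · simp [wordDiff_singleton, onRow]
      · rw [wordDiff_congr (onRow F gs) (fun _ => 0), wordDiff, barDiff_zero]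
        · simp [onRow]
        · rintro (_ | ⟨a, u⟩) hu
          · simp at hu
          · rfl
    · rintro u (_ | ⟨a, y⟩) - hy
      · simp at hy
      · rfl

lemma offCol_pairDiff_offCol (Φ : List α → List α → M) :
    offCol (pairDiff (offCol Φ)) = pairDiff (offCol Φ) := by
  funext gs ks
  rcases gs with _ | ⟨g, gs⟩
  · have h : offCol Φ [] = fun _ => 0 := rfl
    rw [pairDiff, wordDiff, h, barDiff_zero]
    simp [offCol, barDiff]
  · rfl

end Tuples

section Total

variable {α M : Type} [Group α] [AddCommGroup M]

lemma isRiffle_symm_iff (p q : ℕ) (σ : Equiv.Perm (Fin (p + q))) :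
    IsRiffle p σ.symm ↔ IsShuffle p q σ := by
  constructor
  · intro h i j hij hp
    exact h (σ i) (σ j) (by simpa using hij) (by simpa using hp)
  · intro h x y hxy hp
    simpa using h (σ.symm x) (σ.symm y) hxy hp

lemma riffleWord_symm (p q : ℕ) (σ : Equiv.Perm (Fin (p + q))) (gs : Fin p → α)
    (ks : Fin q → α) :
    riffleWord (List.ofFn gs) (List.ofFn ks) σ.symm = List.ofFn (shuffleTuple α p q σ gs ks) := by
  rw [riffleWord]
  congr 1
  funext j
  have hj := (σ.symm j).isLt
  simp only [shuffleTuple, List.length_ofFn, prefixProd, MulAut.conj_apply]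
  split_ifs with h
  · simp [List.getD_eq_getElem?_getD, h]
  · have h' : ((σ.symm j : Fin (p + q)) : ℕ) - p < q := by omega
    simp [List.getD_eq_getElem?_getD, h']

open scoped Classical in
lemma tauBar_sum (p q : ℕ) (gs : Fin p → α) (ks : Fin q → α) (h : (Fin (p + q) → α) → M) :
    (tauBar α p q gs ks).sum (fun t c => c • h t) =
      ∑ σ : Equiv.Perm (Fin (p + q)), if IsShuffle p q σ then
        ((Equiv.Perm.sign σ : ℤˣ) : ℤ) • h (shuffleTuple α p q σ gs ks) else 0 := by
  rw [← Finsupp.linearCombination_apply ℤ, tauBar, map_sum, Finset.sum_filter]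
  simp [Finsupp.linearCombination_single]

lemma tauDualA_apply (n : ℕ) (f : List α → M) (p : Fin n)
    (x : (Fin (p : ℕ) → α) × (Fin (n - (p : ℕ)) → α)) :
    tauDualA α M n (tup n 0 fun w _ => f w) p x =
      shuffleSum (List.ofFn x.1) (List.ofFn x.2) f := by
  classical
  have hpn : (p : ℕ) + (n - p) = n := by have := p.isLt; omega
  have hc : ∀ t : Fin ((p : ℕ) + (n - p)) → α,
      List.ofFn (fun j : Fin n => t (Fin.cast hpn.symm j)) = List.ofFn t := fun t =>
    (List.ofFn_congr hpn t).symm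
  rw [← sum_riffle (N := p + (n - p)) (List.ofFn x.1) (List.ofFn x.2) (by simp) f]
  rw [← Equiv.sum_comp (Equiv.inv (Equiv.Perm (Fin ((p : ℕ) + (n - p)))))]
  simp only [tauDualA, tup, hc]
  rw [tauBar_sum (p : ℕ) (n - p) x.1 x.2 (fun t => f (List.ofFn t))]
  refine Finset.sum_congr rfl fun σ _ => ?_
  simp only [Equiv.inv_apply, Equiv.Perm.inv_def, riffleWord_symm, List.length_ofFn,
    isRiffle_symm_iff, Equiv.Perm.sign_symm]

lemma tauDualA_add (n : ℕ) (F F' : SC α M n) :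
    tauDualA α M n (F + F') = tauDualA α M n F + tauDualA α M n F' := by
  funext p x
  simp only [tauDualA, Pi.add_apply, smul_add, Finsupp.sum_add]

lemma inclBA_add (n : ℕ) (y y' : TotB α α M n) :
    inclBA α M n (y + y') = inclBA α M n y + inclBA α M n y' := by
  funext p
  simp only [inclBA, Pi.add_apply]
  split_ifs
  · rfl
  · simp

lemma inclAC_add (n : ℕ) (y y' : TotA α α M n) :
    inclAC α M n (y + y') = inclAC α M n y + inclAC α M n y' := by
  funext p
  simp only [inclAC, Pi.add_apply]
  split_ifs <;> simp

lemma rowE_add (n : ℕ) (z z' : SC α M n) :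
    rowE α M n (z + z') = rowE α M n z + rowE α M n z' := by
  funext p
  simp only [rowE, Pi.add_apply]
  split_ifs
  · rfl
  · simp

/-- The map `(x, y, z) ↦ τ₁* x + y + π₂* z` on cochains. -/
noncomputable def decompMap (n : ℕ) : SC α M n × TotB α α M n × SC α M n →+ TotC α α M n :=
  AddMonoidHom.mk'
    (fun t => inclAC α M n (tauDualA α M n t.1 + inclBA α M n t.2.1) + rowE α M n t.2.2)
    (by
      rintro ⟨F, y, z⟩ ⟨F', y', z'⟩
      simp only [Prod.mk_add_mk, tauDualA_add, inclBA_add, inclAC_add, rowE_add]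
      abel)

/-- The map `(x, y, z) ↦ τ₁* x + y + π₂* z` on functions of words. -/
def decompWords (f : List α → M) (Ψ : List α → List α → M) (θ : List α → M) :
    List α → List α → M :=
  offRow ((fun gs ks => shuffleSum gs ks f) + offCol Ψ) + onRow θ

lemma decompMap_tup (n : ℕ) (f : List α → M) (Ψ : List α → List α → M) (θ : List α → M) :
    decompMap n (tup n 0 (fun w _ => f w), tupB n Ψ, tup n 0 (fun w _ => θ w)) =
      tupC n (decompWords f Ψ θ) := by
  funext p x
  have hA : ∀ h : (p : ℕ) < n,
      tauDualA α M n (tup n 0 fun w _ => f w) ⟨p, h⟩ x + inclBA α M n (tupB n Ψ) ⟨p, h⟩ x =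
      shuffleSum (List.ofFn x.1) (List.ofFn x.2) f + offCol Ψ (List.ofFn x.1) (List.ofFn x.2) := by
    intro h
    rw [tauDualA_apply]
    congr 1
    simp only [inclBA, tupB, castC_tup]
    split_ifs with h1
    · rcases hl : List.ofFn x.1 with _ | ⟨a, l⟩
      · have := congrArg List.length hl
        rw [List.length_ofFn, List.length_nil] at this
        omega
      · simp [tup, hl, offCol]
    · have : List.ofFn x.1 = [] := List.eq_nil_of_length_eq_zero (by rw [List.length_ofFn]; omega)
      simp [this, offCol]
  simp only [decompMap, AddMonoidHom.mk'_apply, Pi.add_apply, inclAC, rowE, castC_tup, tupC, tup,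
    decompWords]
  rcases hl : List.ofFn x.2 with _ | ⟨k, l⟩
  · have hp : (p : ℕ) = n := by
      have := congrArg List.length hl
      simp at this
      omega
    have hp' : ¬ (p : ℕ) < n := by omega
    rw [dif_neg hp', dif_pos hp]
    simp [offRow, onRow, tup]
  · have hp : (p : ℕ) < n := by
      have := congrArg List.length hl
      simp at this
      omega
    rw [dif_pos hp, dif_neg hp.ne, Pi.add_apply, hA hp, hl]
    simp [offRow, onRow]

lemma pairDiff_decompWords (f : List α → M) (Ψ : List α → List α → M) (θ : List α → M) :
    pairDiff (decompWords f Ψ θ) =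
      decompWords (wordDiff f) (pairDiff (offCol Ψ)) (wordDiff θ) := by
  rw [decompWords, pairDiff_add, pairDiff_offRow, pairDiff_onRow, pairDiff_add, decompWords,
    offCol_pairDiff_offCol]
  congr 3
  funext gs ks
  exact pairDiff_shuffleSum gs ks f

lemma exists_tup_row (n : ℕ) (F : SC α M n) : ∃ f : List α → M, tup n 0 (fun w _ => f w) = F ∧
    (F ∈ nrm α α M n 0 → ∀ w, 1 ∈ w → f w = 0) := by
  refine ⟨fun w => liftWords F w [], ?_, fun hF w hw => liftWords_eq_zero F hF w [] (.inl hw)⟩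
  rw [← tup_liftWords F]
  funext x
  simp [tup, tup_liftWords]

lemma totd_decompMap (n : ℕ) (F : SC α M n) (y : TotB α α M n) (z : SC α M n) :
    totd α α MulAut.conj M n (decompMap n (F, y, z)) =
      decompMap (n + 1) (dGhom α α MulAut.conj M n 0 F, totdB α α MulAut.conj M n y,
        dGhom α α MulAut.conj M n 0 z) := by
  obtain ⟨f, rfl, -⟩ := exists_tup_row n F
  obtain ⟨Ψ, rfl, -⟩ := exists_tupB n y
  obtain ⟨θ, rfl, -⟩ := exists_tup_row n z
  have hb : ∀ f : List α → M, barDiff conjWord (fun w _ => f w) = fun w _ => wordDiff f w := by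
    intro f; funext w x; exact barDiff_const _ _ _ _
  rw [decompMap_tup, totd_tupC, pairDiff_decompWords, dGhom_tup, dGhom_tup, ← tupB_offCol n Ψ,
    totdB_tupB _ _ (fun _ => rfl), hb, hb, decompMap_tup]

lemma decompMap_mem_nrmC (n : ℕ) (F : SC α M n) (y : TotB α α M n) (z : SC α M n)
    (hF : F ∈ nrm α α M n 0) (hy : y ∈ nrmB α α M n) (hz : z ∈ nrm α α M n 0) :
    decompMap n (F, y, z) ∈ nrmC α α M n := by
  obtain ⟨f, rfl, hf⟩ := exists_tup_row n F
  obtain ⟨Ψ, rfl, hΨ⟩ := exists_tupB n y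
  obtain ⟨θ, rfl, hθ⟩ := exists_tup_row n z
  rw [decompMap_tup]
  refine fun p _ => tup_mem_nrm _ _ _ fun gs ks h => ?_
  rcases ks with _ | ⟨k, ks⟩
  · simpa [decompWords, offRow, onRow] using hθ hz gs (by simpa using h)
  · have h1 := shuffleSum_eq_zero gs (k :: ks) f (hf hF) h
    rcases gs with _ | ⟨g, gs⟩
    · simp only [decompWords, Pi.add_apply, offRow, onRow, offCol, h1, add_zero]
    · simp only [decompWords, Pi.add_apply, offRow, onRow, offCol, h1, hΨ hy _ _ h, add_zero]

lemma exists_decompMap_eq (n : ℕ) (w : TotC α α M n) (hw : w ∈ nrmC α α M n) :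
    ∃ F ∈ nrm α α M n 0, ∃ y ∈ nrmB α α M n, ∃ z ∈ nrm α α M n 0,
      decompMap n (F, y, z) = w := by
  obtain ⟨W, rfl, hW⟩ := exists_tupC n w
  replace hW := hW hw
  refine ⟨tup n 0 (fun u _ => W [] u), ?_,
    tupB n (fun u v => W u v - shuffleSum u v (W [])), fun p _ => tup_mem_nrm _ _ _ ?_,
    tup n 0 (fun u _ => W u []), ?_, ?_⟩
  · rintro x (⟨i, hi⟩ | ⟨i, _⟩)
    · exact hW [] _ (.inr (by rw [← hi]; simp))
    · exact i.elim0
  · intro gs ks h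
    rw [hW gs ks h, shuffleSum_eq_zero _ _ _ (fun w hw => hW [] w (.inr hw)) h, sub_zero]
  · rintro x (⟨i, hi⟩ | ⟨i, _⟩)
    · exact hW _ [] (.inl (by rw [← hi]; simp))
    · exact i.elim0
  · rw [decompMap_tup n (W []) _ (fun u => W u [])]
    congr 1
    funext gs ks
    rcases ks with _ | ⟨k, ks⟩
    · simp [decompWords, offRow, onRow]
    · rcases gs with _ | ⟨g, gs⟩
      · simp [decompWords, offRow, onRow, offCol, shuffleSum]
      · simp [decompWords, offRow, onRow, offCol]

lemma decompMap_injective (n : ℕ) (hn : 0 < n) (F : SC α M n) (y : TotB α α M n) (z : SC α M n)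
    (h : decompMap n (F, y, z) = 0) : F = 0 ∧ y = 0 ∧ z = 0 := by
  have h0 : tup n 0 (fun _ _ => 0) = (0 : SC α M n) := rfl
  obtain ⟨Ψ, rfl, -⟩ := exists_tupB n y
  obtain ⟨θ, rfl, -⟩ := exists_tup_row n z
  have hF : F = 0 := by
    obtain ⟨f, rfl, -⟩ := exists_tup_row n F
    rw [decompMap_tup] at h
    funext x
    have := congrFun (congrFun h 0) (fun i => i.elim0, x.1)
    obtain ⟨m, rfl⟩ : ∃ m, n = m + 1 := ⟨n - 1, by omega⟩
    simpa [tupC, tup, decompWords, offRow, onRow, offCol, shuffleSum, List.ofFn_succ] using this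
  subst hF
  rw [← h0, decompMap_tup] at h
  refine ⟨rfl, ?_, ?_⟩
  · funext p x
    have hp := p.isLt
    have := congrFun (congrFun h ⟨p + 1, by omega⟩) x
    simp only [tupC, tup, decompWords] at this
    simp only [tupB, tup]
    rcases hl : List.ofFn x.2 with _ | ⟨k, l⟩
    · have := congrArg List.length hl
      simp at this
      omega
    · rw [hl, List.ofFn_succ] at this
      simpa [offRow, onRow, offCol, shuffleSum_zero, List.ofFn_succ] using this
  · funext x
    have hq : n - n = 0 := by omega
    have := congrFun (congrFun h (Fin.last n)) (x.1, fun i => (i.cast hq).elim0)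
    simp only [tupC, tup, decompWords] at this
    have hl : ∀ v : Fin (n - (Fin.last n : ℕ)) → α, List.ofFn v = [] := fun v =>
      List.eq_nil_of_length_eq_zero (by simp)
    rw [hl] at this
    change θ (List.ofFn x.1) = 0
    simpa [offRow, onRow] using this

end Total

section Quotients

variable {A₁ A₂ A₃ C : Type} [AddCommGroup A₁] [AddCommGroup A₂] [AddCommGroup A₃]
  [AddCommGroup C]

lemma exists_quotient_addEquiv (φ : A₁ × A₂ × A₃ →+ C) (Z₁ B₁ : AddSubgroup A₁)
    (Z₂ B₂ : AddSubgroup A₂) (Z₃ B₃ : AddSubgroup A₃) (Z B : AddSubgroup C)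
    (hZ : ∀ a₁ ∈ Z₁, ∀ a₂ ∈ Z₂, ∀ a₃ ∈ Z₃, φ (a₁, a₂, a₃) ∈ Z)
    (hs : ∀ c ∈ Z, ∃ a₁ ∈ Z₁, ∃ a₂ ∈ Z₂, ∃ a₃ ∈ Z₃, φ (a₁, a₂, a₃) = c)
    (hB : ∀ a₁ a₂ a₃, φ (a₁, a₂, a₃) ∈ B ↔ a₁ ∈ B₁ ∧ a₂ ∈ B₂ ∧ a₃ ∈ B₃) :
    ∃ e : ((Z₁ ⧸ B₁.addSubgroupOf Z₁) × (Z₂ ⧸ B₂.addSubgroupOf Z₂) ×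
        (Z₃ ⧸ B₃.addSubgroupOf Z₃)) ≃+ (Z ⧸ B.addSubgroupOf Z),
      ∀ a₁ h₁ a₂ h₂ a₃ h₃, ∃ hm : φ (a₁, a₂, a₃) ∈ Z,
        e (QuotientAddGroup.mk ⟨a₁, h₁⟩, QuotientAddGroup.mk ⟨a₂, h₂⟩,
          QuotientAddGroup.mk ⟨a₃, h₃⟩) = QuotientAddGroup.mk ⟨φ (a₁, a₂, a₃), hm⟩ := by
  let ψ : Z₁ × Z₂ × Z₃ →+ Z := AddMonoidHom.mk'
    (fun t => ⟨φ (t.1, t.2.1, t.2.2), hZ _ t.1.2 _ t.2.1.2 _ t.2.2.2⟩)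
    (fun s t => Subtype.ext (φ.map_add (s.1.1, s.2.1.1, s.2.2.1) (t.1.1, t.2.1.1, t.2.2.1)))
  let π := QuotientAddGroup.mk' (B.addSubgroupOf Z)
  have hψ : ∀ t, π (ψ t) = 0 ↔ t.1.1 ∈ B₁ ∧ t.2.1.1 ∈ B₂ ∧ t.2.2.1 ∈ B₃ := fun t => by
    rw [← hB]
    exact QuotientAddGroup.eq_zero_iff _
  let f₁ := QuotientAddGroup.lift (B₁.addSubgroupOf Z₁)
    ((π.comp ψ).comp (AddMonoidHom.inl _ _)) (fun x hx => (hψ (x, 0)).2 ⟨hx, B₂.zero_mem, B₃.zero_mem⟩)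
  let f₂ := QuotientAddGroup.lift (B₂.addSubgroupOf Z₂)
    ((π.comp ψ).comp ((AddMonoidHom.inr _ _).comp (AddMonoidHom.inl _ _)))
    (fun x hx => (hψ (0, x, 0)).2 ⟨B₁.zero_mem, hx, B₃.zero_mem⟩)
  let f₃ := QuotientAddGroup.lift (B₃.addSubgroupOf Z₃)
    ((π.comp ψ).comp ((AddMonoidHom.inr _ _).comp (AddMonoidHom.inr _ _)))
    (fun x hx => (hψ (0, 0, x)).2 ⟨B₁.zero_mem, B₂.zero_mem, hx⟩)
  let f := f₁.coprod (f₂.coprod f₃)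
  have hf : ∀ a b c, f (QuotientAddGroup.mk a, QuotientAddGroup.mk b, QuotientAddGroup.mk c) =
      π (ψ (a, b, c)) := by
    intro a b c
    have : (a, b, c) = (a, 0, 0) + ((0, b, 0) + (0, 0, c)) := by simp
    rw [this, map_add, map_add, map_add, map_add]
    rfl
  have hbij : Function.Bijective f := by
    constructor
    · rw [injective_iff_map_eq_zero]
      rintro ⟨a, b, c⟩ h
      induction a using QuotientAddGroup.induction_on with | H a => ?_
      induction b using QuotientAddGroup.induction_on with | H b => ?_
      induction c using QuotientAddGroup.induction_on with | H c => ?_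
      rw [hf, hψ] at h
      refine Prod.ext ?_ (Prod.ext ?_ ?_)
      · exact (QuotientAddGroup.eq_zero_iff _).2 h.1
      · exact (QuotientAddGroup.eq_zero_iff _).2 h.2.1
      · exact (QuotientAddGroup.eq_zero_iff _).2 h.2.2
    · intro c
      induction c using QuotientAddGroup.induction_on with | H c => ?_
      obtain ⟨a₁, h₁, a₂, h₂, a₃, h₃, h⟩ := hs c c.2
      exact ⟨(QuotientAddGroup.mk ⟨a₁, h₁⟩, QuotientAddGroup.mk ⟨a₂, h₂⟩,
        QuotientAddGroup.mk ⟨a₃, h₃⟩), (hf _ _ _).trans (congrArg π (Subtype.ext h))⟩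
  exact ⟨AddEquiv.ofBijective f hbij, fun a₁ h₁ a₂ h₂ a₃ h₃ =>
    ⟨hZ a₁ h₁ a₂ h₂ a₃ h₃, hf _ _ _⟩⟩

end Quotients

/-- For `K` acting on itself by conjugation, the map
`H^p(K,ℤ) ⊕ H^p(Tot^*(B^{*,*}(K ⋊ K, ℤ))) ⊕ H^p(K,ℤ) → H^p(K ⋊ K, ℤ)`,
`(x, y, z) ↦ τ₁* x + y + π₂* z`, is an isomorphism for all `p > 0`, where `H^p(K ⋊ K, ℤ)`
is computed by the total complex of the double bar complex. -/
theorem stmt_11 : ∀ n : ℕ, 0 < n →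
    ∃ e : (HS K ℤ n × HB K K MulAut.conj ℤ n × HS K ℤ n) ≃+ HC K K MulAut.conj ℤ n,
      ∀ (F : SC K ℤ n) (hF : F ∈ ZS K ℤ n) (y : TotB K K ℤ n)
        (hy : y ∈ ZB K K MulAut.conj ℤ n) (z : SC K ℤ n) (hz : z ∈ ZS K ℤ n),
        ∃ hm : inclAC K ℤ n (tauDualA K ℤ n F + inclBA K ℤ n y) + rowE K ℤ n z ∈
            ZC K K MulAut.conj ℤ n,
          e (QuotientAddGroup.mk ⟨F, hF⟩, QuotientAddGroup.mk ⟨y, hy⟩,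
              QuotientAddGroup.mk ⟨z, hz⟩) =
            QuotientAddGroup.mk
              ⟨inclAC K ℤ n (tauDualA K ℤ n F + inclBA K ℤ n y) + rowE K ℤ n z, hm⟩ := by
  intro n hn
  obtain ⟨m, rfl⟩ : ∃ m, n = m + 1 := ⟨n - 1, by omega⟩
  refine exists_quotient_addEquiv (decompMap (m + 1)) (ZS K ℤ (m + 1)) (BS K ℤ (m + 1))
    (ZB K K MulAut.conj ℤ (m + 1)) (BB K K MulAut.conj ℤ (m + 1)) (ZS K ℤ (m + 1))
    (BS K ℤ (m + 1)) (ZC K K MulAut.conj ℤ (m + 1)) (BC K K MulAut.conj ℤ (m + 1)) ?_ ?_ ?_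
  · intro F hF y hy z hz
    refine ⟨decompMap_mem_nrmC _ F y z hF.1 hy.1 hz.1, ?_⟩
    refine AddMonoidHom.mem_ker.2 ?_
    rw [totd_decompMap, AddMonoidHom.mem_ker.1 hF.2,
      AddMonoidHom.mem_ker.1 hy.2, AddMonoidHom.mem_ker.1 hz.2]
    exact map_zero _
  · intro w hw
    obtain ⟨F, hF, y, hy, z, hz, rfl⟩ := exists_decompMap_eq _ w hw.1
    have h := AddMonoidHom.mem_ker.1 hw.2
    rw [totd_decompMap] at h
    obtain ⟨h1, h2, h3⟩ := decompMap_injective _ (by omega) _ _ _ h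
    exact ⟨F, ⟨hF, h1⟩, y, ⟨hy, h2⟩, z, ⟨hz, h3⟩, rfl⟩
  · intro F y z
    constructor
    · rintro ⟨w, hw, hd⟩
      obtain ⟨F', hF, y', hy, z', hz, rfl⟩ := exists_decompMap_eq _ w hw
      rw [totd_decompMap, ← sub_eq_zero, ← map_sub] at hd
      obtain ⟨h1, h2, h3⟩ := decompMap_injective _ (by omega) _ _ _ hd
      exact ⟨⟨F', hF, sub_eq_zero.1 h1⟩, ⟨y', hy, sub_eq_zero.1 h2⟩, ⟨z', hz, sub_eq_zero.1 h3⟩⟩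
    · rintro ⟨⟨F', hF, rfl⟩, ⟨y', hy, rfl⟩, ⟨z', hz, rfl⟩⟩
      exact ⟨_, decompMap_mem_nrmC _ F' y' z' hF hy hz, totd_decompMap _ _ _ _⟩

end Stmt11
end
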